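/- Let U be a nondiscrete unital subring of ℝ and let A be a square nonnegative matrix over U of eventual rank one with nonzero eigenvalue λ (so the characteristic polynomial of A is t^m(t−λ) with λ ≠ 0). Then: (1) if U is a Dedekind domain and A is shift equivalent over U to the 1×1 matrix (λ), then A is strong shift equivalent over U₊ to the 1×1 matrix (λ); (2) if U is a principal ideal domain, then A is strong shift equivalent over U₊ to the 1×1 matrix (λ). -/

import Mathlib

open Matrix Polynomial

/-- All entries of a real matrix lie in the set `S`. -/
def entriesIn {m n : ℕ} (S : Set ℝ) (A : Matrix (Fin m) (Fin n) ℝ) : Prop :=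
  ∀ i j, A i j ∈ S

/-- Elementary strong shift equivalence over `S` between square real matrices
(of possibly different sizes). -/
def ESSE (S : Set ℝ) (p q : (n : ℕ) × Matrix (Fin n) (Fin n) ℝ) : Prop :=
  ∃ (R : Matrix (Fin p.1) (Fin q.1) ℝ) (S' : Matrix (Fin q.1) (Fin p.1) ℝ),
    entriesIn S R ∧ entriesIn S S' ∧ p.2 = R * S' ∧ q.2 = S' * R

/-- Strong shift equivalence over `S`: a finite chain of elementary strong shift
equivalences. -/
def SSE (S : Set ℝ) : ((n : ℕ) × Matrix (Fin n) (Fin n) ℝ) →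
    ((n : ℕ) × Matrix (Fin n) (Fin n) ℝ) → Prop :=
  Relation.ReflTransGen (ESSE S)

/-- `A` is shift equivalent over `S` to the `1×1` matrix `(lam)`. -/
def ShiftEquivToScalar (S : Set ℝ) {N : ℕ} (A : Matrix (Fin N) (Fin N) ℝ) (lam : ℝ) : Prop :=
  ∃ (ℓ : ℕ) (R : Matrix (Fin N) (Fin 1) ℝ) (Sm : Matrix (Fin 1) (Fin N) ℝ),
    1 ≤ ℓ ∧ entriesIn S R ∧ entriesIn S Sm ∧
    A ^ ℓ = R * Sm ∧ (Matrix.of fun _ _ => lam) ^ ℓ = Sm * R ∧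
    A * R = R * Matrix.of (fun _ _ => lam) ∧ Sm * A = (Matrix.of fun _ _ => lam) * Sm

lemma esse_symm {S : Set ℝ} {p q : (n : ℕ) × Matrix (Fin n) (Fin n) ℝ} (h : ESSE S p q) :
    ESSE S q p := by
  obtain ⟨R, S', hR, hS, h1, h2⟩ := h
  exact ⟨S', R, hS, hR, h2, h1⟩

lemma sse_symm {S : Set ℝ} {p q : (n : ℕ) × Matrix (Fin n) (Fin n) ℝ} (h : SSE S p q) :
    SSE S q p := by
  have : Std.Symm (ESSE S) := ⟨fun _ _ => esse_symm⟩
  exact Relation.ReflTransGen.stdSymm.symm _ _ h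

lemma SSE.mono {S T : Set ℝ} (hST : S ⊆ T) {p q : (n : ℕ) × Matrix (Fin n) (Fin n) ℝ}
    (h : SSE S p q) : SSE T p q := by
  refine Relation.ReflTransGen.mono ?_ _ _ h
  rintro a b ⟨R, S', hR, hS, h1, h2⟩
  exact ⟨R, S', fun i j => hST (hR i j), fun i j => hST (hS i j), h1, h2⟩

/-- The matrix `M` is the matrix of `T ⊕ 0` for a splitting of a free module of rank `a` as the
direct sum of `P` and a complement. -/
def Represents {U P : Type*} [CommRing U] [AddCommGroup P] [Module U P] {a : ℕ}
    (M : Matrix (Fin a) (Fin a) U) (T : Module.End U P) : Prop :=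
  ∃ (i : P →ₗ[U] (Fin a → U)) (p : (Fin a → U) →ₗ[U] P),
    p ∘ₗ i = LinearMap.id ∧ Matrix.toLin' M = i ∘ₗ T ∘ₗ p

lemma exists_represents {U P : Type*} [CommRing U] [AddCommGroup P] [Module U P]
    [Module.Finite U P] [Module.Projective U P] (T : Module.End U P) :
    ∃ (a : ℕ) (M : Matrix (Fin a) (Fin a) U), Represents M T := by
  obtain ⟨a, p, hp⟩ := Module.Finite.exists_fin' U P
  obtain ⟨i, hi⟩ := Module.projective_lifting_property p LinearMap.id hp
  exact ⟨a, LinearMap.toMatrix' (i ∘ₗ T ∘ₗ p), i, p, hi, by simp⟩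

lemma esse_of_represents (U : Subring ℝ) {P Q : Type*} [AddCommGroup P] [Module U P]
    [AddCommGroup Q] [Module U Q] {a b : ℕ} {M : Matrix (Fin a) (Fin a) U}
    {M' : Matrix (Fin b) (Fin b) U} {f : P →ₗ[U] Q} {g : Q →ₗ[U] P}
    (hM : Represents M (g ∘ₗ f)) (hM' : Represents M' (f ∘ₗ g)) :
    ESSE (U : Set ℝ) ⟨a, M.map U.subtype⟩ ⟨b, M'.map U.subtype⟩ := by
  obtain ⟨i, p, hip, hM⟩ := hM
  obtain ⟨j, q, hjq, hM'⟩ := hM'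
  refine ⟨(LinearMap.toMatrix' (i ∘ₗ g ∘ₗ q)).map U.subtype,
    (LinearMap.toMatrix' (j ∘ₗ f ∘ₗ p)).map U.subtype, fun x y => Subtype.property _,
    fun x y => Subtype.property _, ?_, ?_⟩
  · dsimp only
    rw [← Matrix.map_mul, ← LinearMap.toMatrix'_comp]
    congr 1
    apply Matrix.toLin'.injective
    rw [hM, Matrix.toLin'_toMatrix']
    refine LinearMap.ext fun x => ?_
    have := fun y => LinearMap.congr_fun hjq y
    simp only [LinearMap.comp_apply, LinearMap.id_apply] at this ⊢
    simp [this]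
  · dsimp only
    rw [← Matrix.map_mul, ← LinearMap.toMatrix'_comp]
    congr 1
    apply Matrix.toLin'.injective
    rw [hM', Matrix.toLin'_toMatrix']
    refine LinearMap.ext fun x => ?_
    have := fun y => LinearMap.congr_fun hip y
    simp only [LinearMap.comp_apply, LinearMap.id_apply] at this ⊢
    simp [this]

/-- If `Y ≤ X` and `T` maps `X` into `Y`, then the restrictions of `T` to `X` and `Y` are
elementary strong shift equivalent. -/
lemma esse_restrict (U : Subring ℝ) {E : Type*} [AddCommGroup E] [Module U E]
    (T : Module.End U E) {X Y : Submodule U E} (hYX : Y ≤ X) (hT : ∀ x ∈ X, T x ∈ Y)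
    {a b : ℕ} {M : Matrix (Fin a) (Fin a) U} {M' : Matrix (Fin b) (Fin b) U}
    (hM : Represents M (T.restrict (fun x hx => hYX (hT x hx))))
    (hM' : Represents M' (T.restrict (fun x hx => hT x (hYX hx)))) :
    ESSE (U : Set ℝ) ⟨a, M.map U.subtype⟩ ⟨b, M'.map U.subtype⟩ :=
  esse_of_represents U (f := T.restrict hT) (g := Submodule.inclusion hYX) hM hM'

lemma projective_submodule_of_isDedekindDomain {U : Type*} [CommRing U] [IsDedekindDomain U]
    {n : ℕ} (X : Submodule U (Fin n → U)) : Module.Projective U X := by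
  have : Module.FinitePresentation U X := Module.finitePresentation_of_finite U X
  exact Module.Flat.projective_of_finitePresentation

/-- Along a decreasing chain of submodules with `T (X j) ⊆ X (j + 1) ⊆ X j`, all restrictions of
`T` are strong shift equivalent. -/
lemma sse_restrict_chain (U : Subring ℝ) [IsDedekindDomain U] {n : ℕ}
    (T : Module.End U (Fin n → U)) (X : ℕ → Submodule U (Fin n → U))
    (hanti : ∀ j, X (j + 1) ≤ X j) (hT : ∀ j, ∀ x ∈ X j, T x ∈ X (j + 1)) (k : ℕ)
    {a b : ℕ} {M : Matrix (Fin a) (Fin a) U} {M' : Matrix (Fin b) (Fin b) U}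
    (hM : Represents M (T.restrict (fun x hx => hanti 0 (hT 0 x hx))))
    (hM' : Represents M' (T.restrict (fun x hx => hanti k (hT k x hx)))) :
    SSE (U : Set ℝ) ⟨a, M.map U.subtype⟩ ⟨b, M'.map U.subtype⟩ := by
  induction k generalizing b with
  | zero =>
    refine Relation.ReflTransGen.single
      (esse_of_represents U (f := LinearMap.id)
        (g := (T.restrict (fun x hx => hanti 0 (hT 0 x hx)))) hM hM')
  | succ k ih =>
    have := projective_submodule_of_isDedekindDomain (X k)
    obtain ⟨c, L, hL⟩ := exists_represents (T.restrict (fun x hx => hanti k (hT k x hx)))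
    exact (ih hL).tail (esse_restrict U T (hanti k) (hT k) hL hM')

/-- Over a Dedekind domain, shift equivalence to a `1 × 1` matrix implies strong shift
equivalence. -/
lemma sse_of_shiftEquiv_scalar (U : Subring ℝ) [IsDedekindDomain U] {N ℓ : ℕ}
    (A : Matrix (Fin N) (Fin N) U) (lam : U) (hlam : lam ≠ 0) (r s : Fin N → U)
    (hpow : ∀ v, (A ^ ℓ) *ᵥ v = (s ⬝ᵥ v) • r) (hsr : s ⬝ᵥ r = lam ^ ℓ)
    (hs : s ᵥ* A = lam • s) :
    SSE (U : Set ℝ) ⟨N, A.map U.subtype⟩ ⟨1, (Matrix.of fun _ _ => lam).map U.subtype⟩ := by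
  set T : Module.End U (Fin N → U) := Matrix.toLin' A with hTdef
  have hTpow : ∀ v, (T ^ ℓ) v = (s ⬝ᵥ v) • r := by
    intro v
    rw [hTdef, ← Matrix.toLin'_pow, Matrix.toLin'_apply, hpow]
  let X : ℕ → Submodule U (Fin N → U) := fun j => LinearMap.range (T ^ j)
  have hXanti : ∀ j, X (j + 1) ≤ X j := by
    rintro j _ ⟨v, rfl⟩
    exact ⟨T v, by rw [pow_succ]; rfl⟩
  have hXT : ∀ j, ∀ x ∈ X j, T x ∈ X (j + 1) := by
    rintro j _ ⟨v, rfl⟩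
    exact ⟨v, by rw [pow_succ']; rfl⟩
  let sL : (Fin N → U) →ₗ[U] (Fin 1 → U) :=
    LinearMap.pi fun _ => dotProductBilin U U s
  have hsL : ∀ v i, sL v i = s ⬝ᵥ v := fun v i => rfl
  let D : Module.End U (Fin 1 → U) := Matrix.toLin' (Matrix.of fun _ _ => lam)
  have hD : ∀ v, D v = lam • v := by
    intro v
    ext i
    fin_cases i
    simp [D, Matrix.mulVec, dotProduct]
  have hsT : ∀ v, sL (T v) = D (sL v) := by
    intro v
    rw [hD]
    ext i
    simp only [hsL, hTdef, Matrix.toLin'_apply, Matrix.dotProduct_mulVec, hs, smul_dotProduct,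
      Pi.smul_apply]
  let J : Submodule U (Fin 1 → U) := (X ℓ).map sL
  let Y : ℕ → Submodule U (Fin 1 → U) := fun j => J ⊔ LinearMap.range (D ^ j)
  have hDJ : ∀ x ∈ J, D x ∈ J := by
    rintro _ ⟨v, hv, rfl⟩
    exact ⟨T v, hXanti ℓ (hXT ℓ v hv), hsT v⟩
  have hYanti : ∀ j, Y (j + 1) ≤ Y j := by
    intro j
    refine sup_le_sup_left ?_ _
    rintro _ ⟨v, rfl⟩
    exact ⟨D v, by rw [pow_succ]; rfl⟩
  have hYT : ∀ j, ∀ x ∈ Y j, D x ∈ Y (j + 1) := by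
    intro j x hx
    obtain ⟨y, hy, _, ⟨v, rfl⟩, rfl⟩ := Submodule.mem_sup.1 hx
    rw [map_add]
    exact Submodule.add_mem_sup (hDJ y hy) ⟨v, by rw [pow_succ']; rfl⟩
  have hDpow : ∀ j v, (D ^ j) v = lam ^ j • v := by
    intro j
    induction j with
    | zero => simp
    | succ j ih => intro v; rw [pow_succ', Module.End.mul_apply, ih, hD, smul_smul, pow_succ']
  have hYend : Y (2 * ℓ) = J := by
    refine sup_eq_left.2 ?_
    rintro _ ⟨v, rfl⟩
    refine ⟨(T ^ ℓ) (v 0 • r), ⟨_, rfl⟩, ?_⟩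
    ext i
    fin_cases i
    simp [hsL, hTpow, hDpow, hsr]
    ring
  have hY0 : Y 0 = ⊤ := by
    refine eq_top_iff.2 (le_trans ?_ le_sup_right)
    intro v _
    exact ⟨v, by simp⟩
  have hinj : ∀ v ∈ X ℓ, sL v = 0 → v = 0 := by
    rintro _ ⟨v, rfl⟩ h
    have h0 := congrFun h 0
    rw [hsL, hTpow, dotProduct_smul, hsr] at h0
    have : s ⬝ᵥ v = 0 := by
      rcases mul_eq_zero.1 h0 with h | h
      · exact h
      · exact absurd h (pow_ne_zero _ hlam)
    rw [hTpow, this, zero_smul]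
  have := projective_submodule_of_isDedekindDomain (X ℓ)
  have := projective_submodule_of_isDedekindDomain (Y (2 * ℓ))
  obtain ⟨a, M, hM⟩ := exists_represents (T.restrict (fun x hx => hXanti ℓ (hXT ℓ x hx)))
  obtain ⟨b, L, hL⟩ := exists_represents (D.restrict (fun x hx => hYanti (2 * ℓ) (hYT (2 * ℓ) x hx)))
  have h1 : SSE (U : Set ℝ) ⟨N, A.map U.subtype⟩ ⟨a, M.map U.subtype⟩ := by
    refine sse_restrict_chain U T X hXanti hXT ℓ ?_ hM
    refine ⟨Submodule.subtype _, LinearMap.codRestrict _ LinearMap.id (fun v => ⟨v, by simp⟩),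
      rfl, rfl⟩
  have h3 : SSE (U : Set ℝ) ⟨1, (Matrix.of fun _ _ => lam).map U.subtype⟩ ⟨b, L.map U.subtype⟩ := by
    refine sse_restrict_chain U D Y hYanti hYT (2 * ℓ) ?_ hL
    refine ⟨Submodule.subtype _, LinearMap.codRestrict _ LinearMap.id
      (fun v => by rw [hY0]; trivial), rfl, rfl⟩
  have hmem : ∀ v ∈ X ℓ, sL v ∈ Y (2 * ℓ) := fun v hv => hYend.symm ▸ ⟨v, hv, rfl⟩
  let e : X ℓ ≃ₗ[U] Y (2 * ℓ) := LinearEquiv.ofBijective (sL.restrict hmem) ⟨by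
      rw [injective_iff_map_eq_zero]
      rintro ⟨v, hv⟩ h
      exact Subtype.ext (hinj v hv (congrArg Subtype.val h)), by
      rintro ⟨w, hw⟩
      obtain ⟨v, hv, rfl⟩ : w ∈ J := hYend ▸ hw
      exact ⟨⟨v, hv⟩, rfl⟩⟩
  have h2 : ESSE (U : Set ℝ) ⟨a, M.map U.subtype⟩ ⟨b, L.map U.subtype⟩ := by
    refine esse_of_represents U
      (f := e.toLinearMap ∘ₗ (T.restrict (fun x hx => hXanti ℓ (hXT ℓ x hx))))
      (g := e.symm.toLinearMap) ?_ ?_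
    · convert hM using 1
      ext x : 1
      simp
    · convert hL using 1
      ext x : 1
      obtain ⟨v, rfl⟩ := e.surjective x
      simp only [LinearMap.comp_apply, LinearEquiv.coe_coe, LinearEquiv.symm_apply_apply]
      exact Subtype.ext (hsT v.1)
  exact (h1.tail h2).trans (sse_symm h3)

lemma sub_smul_idempotent_pow {n : ℕ} {lam : ℝ} {A E : Matrix (Fin n) (Fin n) ℝ}
    (hAE : A * E = lam • E) (hEA : E * A = lam • E) (hEE : E * E = E) (j : ℕ) :
    (A - lam • E) ^ (j + 1) = A ^ (j + 1) - lam ^ (j + 1) • E := by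
  have hA : ∀ j, A ^ (j + 1) * E = lam ^ (j + 1) • E := by
    intro j
    induction j with
    | zero => simp [hAE]
    | succ j ih => rw [pow_succ', mul_assoc, ih, mul_smul_comm, hAE, smul_smul, ← pow_succ]
  induction j with
  | zero => simp
  | succ j ih =>
    rw [pow_succ, ih, sub_mul, mul_sub, mul_sub, mul_smul_comm, hA, smul_mul_assoc, hEA,
      smul_mul_smul_comm, hEE, ← pow_succ, smul_smul, smul_smul, ← pow_succ, ← pow_succ']
    abel

/-- `A` is eventually rank one with nonzero eigenvalue `lam`, right eigenvector `r` and left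
eigenvector `l`, normalized by `l ⬝ᵥ r = 1`. -/
structure EvRankOne {n : ℕ} (lam : ℝ) (A : Matrix (Fin n) (Fin n) ℝ) (r l : Fin n → ℝ) : Prop where
  right : A *ᵥ r = lam • r
  left : l ᵥ* A = lam • l
  dot : l ⬝ᵥ r = 1
  pow : ∃ k, 1 ≤ k ∧ A ^ k = lam ^ k • vecMulVec r l

namespace EvRankOne

variable {n m : ℕ} {lam : ℝ} {A : Matrix (Fin n) (Fin n) ℝ} {r l : Fin n → ℝ}

lemma mul_proj (h : EvRankOne lam A r l) : A * vecMulVec r l = lam • vecMulVec r l := by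
  rw [Matrix.mul_vecMulVec, h.right, Matrix.smul_vecMulVec]

lemma proj_mul (h : EvRankOne lam A r l) : vecMulVec r l * A = lam • vecMulVec r l := by
  rw [Matrix.vecMulVec_mul, h.left, Matrix.vecMulVec_smul]

lemma proj_mul_proj (h : EvRankOne lam A r l) :
    vecMulVec r l * vecMulVec r l = vecMulVec r l := by
  rw [Matrix.vecMulVec_mul_vecMulVec, h.dot, one_smul]

lemma nilpotent (h : EvRankOne lam A r l) : IsNilpotent (A - lam • vecMulVec r l) := by
  obtain ⟨k, hk, hpow⟩ := h.pow
  obtain ⟨j, rfl⟩ : ∃ j, k = j + 1 := ⟨k - 1, by omega⟩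
  exact ⟨j + 1, by
    rw [sub_smul_idempotent_pow h.mul_proj h.proj_mul h.proj_mul_proj, hpow, sub_self]⟩

lemma trace_eq (h : EvRankOne lam A r l) : A.trace = lam := by
  have h1 := (Matrix.isNilpotent_trace_of_isNilpotent h.nilpotent).eq_zero
  have h2 := h.dot
  rw [dotProduct_comm] at h2
  rw [Matrix.trace_sub, Matrix.trace_smul, Matrix.trace_vecMulVec, h2, smul_eq_mul, mul_one] at h1
  linarith

lemma nonempty (h : EvRankOne lam A r l) : Nonempty (Fin n) := by
  by_contra hn
  have := h.dot
  simp [dotProduct, not_nonempty_iff.1 hn] at this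

/-- Passing from `R * S` to `S * R` preserves the property of being eventually rank one. -/
lemma comm {R : Matrix (Fin n) (Fin m) ℝ} {S : Matrix (Fin m) (Fin n) ℝ}
    (h : EvRankOne lam A r l) (hlam : lam ≠ 0) (hA : A = R * S) :
    EvRankOne lam (S * R) (S *ᵥ r) (lam⁻¹ • (l ᵥ* R)) := by
  subst hA
  refine ⟨?_, ?_, ?_, ?_⟩
  · rw [← Matrix.mulVec_smul, ← h.right]
    simp [Matrix.mulVec_mulVec, Matrix.mul_assoc]
  · rw [Matrix.smul_vecMul, smul_comm, Matrix.vecMul_vecMul, ← Matrix.mul_assoc,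
      ← Matrix.vecMul_vecMul, h.left, Matrix.smul_vecMul]
  · rw [smul_dotProduct, Matrix.dotProduct_mulVec, Matrix.vecMul_vecMul, h.left, smul_dotProduct,
      h.dot, smul_eq_mul, smul_eq_mul, mul_one, inv_mul_cancel₀ hlam]
  · obtain ⟨k, hk, hpow⟩ := h.pow
    have key : ∀ j, (S * R) ^ (j + 1) = S * (R * S) ^ j * R := by
      intro j
      induction j with
      | zero => simp
      | succ j ih => rw [pow_succ, ih, pow_succ (R * S)]; simp only [Matrix.mul_assoc]
    refine ⟨k + 1, by omega, ?_⟩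
    rw [key, hpow, Matrix.mul_smul, Matrix.smul_mul, Matrix.mul_vecMulVec, Matrix.vecMulVec_mul,
      Matrix.vecMulVec_smul, smul_smul, pow_succ, mul_assoc, mul_inv_cancel₀ hlam, mul_one]

/-- The eigenvectors of a matrix with a positive power may be taken positive. -/
lemma exists_pos (h : EvRankOne lam A r l) (hlam : 0 < lam)
    (hpos : ∀ k, 1 ≤ k → ∀ i j, 0 < (A ^ k) i j) :
    ∃ r' l', EvRankOne lam A r' l' ∧ (∀ i, 0 < r' i) ∧ ∀ i, 0 < l' i := by
  obtain ⟨k, hk, hpow⟩ := h.pow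
  obtain ⟨i₀⟩ := h.nonempty
  have hrl : ∀ i j, 0 < r i * l j := by
    intro i j
    have := hpos k hk i j
    rw [hpow, Matrix.smul_apply, Matrix.vecMulVec_apply, smul_eq_mul] at this
    exact pos_of_mul_pos_right this (pow_pos hlam k).le
  have hl0 : l i₀ ≠ 0 := fun h0 => by simpa [h0] using hrl i₀ i₀
  refine ⟨l i₀ • r, (l i₀)⁻¹ • l, ⟨?_, ?_, ?_, k, hk, ?_⟩, ?_, ?_⟩
  · rw [Matrix.mulVec_smul, h.right, smul_comm]
  · rw [Matrix.smul_vecMul, h.left, smul_comm]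
  · rw [smul_dotProduct, dotProduct_smul, h.dot, smul_eq_mul, smul_eq_mul, mul_one,
      inv_mul_cancel₀ hl0]
  · rw [hpow, Matrix.smul_vecMulVec, Matrix.vecMulVec_smul, smul_smul (l i₀), mul_inv_cancel₀ hl0,
      one_smul]
  · intro i
    simpa [mul_comm] using hrl i i₀
  · intro i
    have h1 := hrl i₀ i
    have h2 := hrl i₀ i₀
    have : (l i₀)⁻¹ * l i = (r i₀ * l i) / (r i₀ * l i₀) := by
      have : r i₀ ≠ 0 := fun h0 => by simp [h0] at h2
      field_simp
    simpa [this] using div_pos h1 h2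

end EvRankOne

lemma evRankOne_of_charpoly {N : ℕ} (A : Matrix (Fin N) (Fin N) ℝ) {lam : ℝ} (hlam : lam ≠ 0)
    (hchar : A.charpoly = X ^ (N - 1) * (X - C lam)) :
    ∃ r l, EvRankOne lam A r l := by
  have hN : N ≠ 0 := by
    rintro rfl
    have h1 := congrArg (Polynomial.eval lam) hchar
    simp at h1
  obtain ⟨m, rfl⟩ := Nat.exists_eq_succ_of_ne_zero hN
  have htr : A.trace = lam := by
    rw [Matrix.trace_eq_neg_charpoly_coeff, hchar]
    have : (X ^ (m + 1 - 1) * (X - C lam) : ℝ[X]) = X ^ (m + 1) - C lam * X ^ m := by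
      rw [Nat.add_sub_cancel]; ring
    rw [Nat.succ_eq_add_one, this]
    simp [Polynomial.coeff_X_pow]
  have hCH : A ^ (m + 1) = lam • A ^ m := by
    have h1 := Matrix.aeval_self_charpoly A
    rw [hchar] at h1
    simp only [Nat.succ_eq_add_one, Nat.add_sub_cancel, map_mul, map_pow, aeval_X, map_sub,
      aeval_C, mul_sub, ← pow_succ] at h1
    rw [sub_eq_zero] at h1
    rw [h1, Algebra.algebraMap_eq_smul_one, mul_smul_comm, mul_one]
  have hpow : ∀ j, A ^ (m + 1 + j) = lam ^ j • A ^ (m + 1) := by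
    intro j
    induction j with
    | zero => simp
    | succ j ih =>
      have h2 : A ^ (m + 1 + 1) = lam • A ^ (m + 1) := by
        rw [pow_succ, hCH, smul_mul_assoc, ← pow_succ, hCH]
      rw [← add_assoc, pow_succ, ih, smul_mul_assoc, ← pow_succ, h2, smul_smul, ← pow_succ]
  set c := lam ^ (m + 1) with hc
  have hc0 : c ≠ 0 := pow_ne_zero _ hlam
  set E := c⁻¹ • A ^ (m + 1) with hE
  have hAE : A ^ (m + 1) = c • E := by rw [hE, smul_smul, mul_inv_cancel₀ hc0, one_smul]
  have hEE : E * E = E := by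
    rw [hE, smul_mul_smul_comm, ← pow_add, hpow, smul_smul, mul_assoc, inv_mul_cancel₀ hc0, mul_one]
  have hAmE : A * E = lam • E := by
    rw [hE, mul_smul_comm, ← pow_succ', hpow 1, pow_one, smul_comm]
  have hEmA : E * A = lam • E := by
    rw [hE, smul_mul_assoc, ← pow_succ, hpow 1, pow_one, smul_comm]
  have htrE : E.trace = 1 := by
    have h0 : IsNilpotent (A - lam • E) := ⟨m + 1, by
      rw [sub_smul_idempotent_pow hAmE hEmA hEE, hAE, sub_self]⟩
    have h1 := (Matrix.isNilpotent_trace_of_isNilpotent h0).eq_zero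
    rw [Matrix.trace_sub, Matrix.trace_smul, htr, smul_eq_mul, sub_eq_zero] at h1
    exact mul_left_cancel₀ hlam (by rw [← h1, mul_one])
  have hid : IsIdempotentElem (Matrix.toLin' E) := by
    change Matrix.toLin' E * Matrix.toLin' E = _
    rw [Module.End.mul_eq_comp, ← Matrix.toLin'_mul, hEE]
  have hfin : Module.finrank ℝ (LinearMap.range (Matrix.toLin' E)) = 1 := by
    have h1 := LinearMap.IsProj.trace (LinearMap.IsIdempotentElem.isProj_range _ hid)
    rw [Matrix.trace_toLin'_eq, htrE] at h1
    exact_mod_cast h1.symm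
  obtain ⟨⟨r, hr⟩, hr0, hspan⟩ := finrank_eq_one_iff'.1 hfin
  have hr0 : r ≠ 0 := fun h0 => hr0 (Subtype.ext h0)
  have hcol : ∀ j, ∃ c : ℝ, c • r = E.col j := by
    intro j
    obtain ⟨c, hc⟩ := hspan ⟨E.col j, Pi.single j 1, by simp⟩
    exact ⟨c, congrArg Subtype.val hc⟩
  choose l hl using hcol
  have hErl : E = vecMulVec r l := by
    ext i j
    have := congrFun (hl j) i
    simp only [Pi.smul_apply, smul_eq_mul, Matrix.col_apply] at this
    rw [Matrix.vecMulVec_apply, ← this, mul_comm]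
  have hdot : l ⬝ᵥ r = 1 := by
    rw [dotProduct_comm, ← Matrix.trace_vecMulVec, ← hErl, htrE]
  have hl1 : E *ᵥ r = r := by rw [hErl, Matrix.vecMulVec_mulVec, hdot]; simp
  have hr1 : l ᵥ* E = l := by rw [hErl, Matrix.vecMul_vecMulVec, hdot, one_smul]
  refine ⟨r, l, ?_, ?_, hdot, m + 1, by omega, by rw [hAE, hErl]⟩
  · conv_lhs => rw [← hl1]
    rw [Matrix.mulVec_mulVec, hAmE, Matrix.smul_mulVec, hl1]
  · conv_lhs => rw [← hr1]
    rw [Matrix.vecMul_vecMul, hEmA, Matrix.vecMul_smul, hr1]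

lemma scalar_one_eq_smul_one (lam : ℝ) :
    (Matrix.of fun _ _ => lam : Matrix (Fin 1) (Fin 1) ℝ) = lam • 1 := by
  ext i j
  simp [Subsingleton.elim i j]

lemma mul_scalar_one {N : ℕ} (R : Matrix (Fin N) (Fin 1) ℝ) (lam : ℝ) :
    R * (Matrix.of fun _ _ => lam : Matrix (Fin 1) (Fin 1) ℝ) = lam • R := by
  rw [scalar_one_eq_smul_one, Matrix.mul_smul, Matrix.mul_one]

lemma scalar_one_mul {N : ℕ} (S : Matrix (Fin 1) (Fin N) ℝ) (lam : ℝ) :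
    (Matrix.of fun _ _ => lam : Matrix (Fin 1) (Fin 1) ℝ) * S = lam • S := by
  rw [scalar_one_eq_smul_one, Matrix.smul_mul, Matrix.one_mul]

lemma sse_of_shiftEquivToScalar (U : Subring ℝ) [IsDedekindDomain U] {N : ℕ}
    {A : Matrix (Fin N) (Fin N) ℝ} (hAU : entriesIn (U : Set ℝ) A) {lam : ℝ} (hlam : lam ≠ 0)
    (hlamU : lam ∈ U) (h : ShiftEquivToScalar (U : Set ℝ) A lam) :
    SSE (U : Set ℝ) ⟨N, A⟩ ⟨1, Matrix.of fun _ _ => lam⟩ := by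
  obtain ⟨ℓ, R, S, -, hRU, hSU, hRS, hSR, -, hSA⟩ := h
  let A' : Matrix (Fin N) (Fin N) U := Matrix.of fun i j => ⟨A i j, hAU i j⟩
  let r : Fin N → U := fun i => ⟨R i 0, hRU i 0⟩
  let s : Fin N → U := fun j => ⟨S 0 j, hSU 0 j⟩
  have hmap : U.subtype.mapMatrix A' = A := rfl
  have hpow : A' ^ ℓ = vecMulVec r s := by
    apply Matrix.map_injective (f := U.subtype) Subtype.val_injective
    change U.subtype.mapMatrix (A' ^ ℓ) = _
    rw [map_pow, hmap, hRS]
    ext i j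
    simp [Matrix.mul_apply, Matrix.vecMulVec_apply, r, s]
  have hmain := sse_of_shiftEquiv_scalar U A' ⟨lam, hlamU⟩
    (fun h0 => hlam (congrArg Subtype.val h0)) r s (ℓ := ℓ) ?_ ?_ ?_
  · exact hmain
  · intro v
    rw [hpow, Matrix.vecMulVec_mulVec]
    ext i
    simp [mul_comm]
  · apply Subtype.ext
    rw [scalar_one_eq_smul_one, _root_.smul_pow, one_pow] at hSR
    have := congrFun (congrFun hSR 0) 0
    simpa [Matrix.mul_apply, dotProduct, r, s] using this.symm
  · ext j
    have := congrFun (congrFun (hSA.trans (scalar_one_mul S lam)) 0) j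
    simpa [Matrix.mul_apply, dotProduct, Matrix.vecMul, r, s, A'] using this

lemma entriesIn_mul {U : Subring ℝ} {a b c : ℕ} {A : Matrix (Fin a) (Fin b) ℝ}
    {B : Matrix (Fin b) (Fin c) ℝ} (hA : entriesIn (U : Set ℝ) A)
    (hB : entriesIn (U : Set ℝ) B) : entriesIn (U : Set ℝ) (A * B) := by
  intro i j
  rw [Matrix.mul_apply]
  exact U.sum_mem fun k _ => U.mul_mem (hA i k) (hB k j)

lemma entriesIn_one {U : Subring ℝ} {a : ℕ} :
    entriesIn (U : Set ℝ) (1 : Matrix (Fin a) (Fin a) ℝ) := by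
  intro i j
  rw [Matrix.one_apply]
  split_ifs
  exacts [U.one_mem, U.zero_mem]

lemma entriesIn_pow {U : Subring ℝ} {a : ℕ} {A : Matrix (Fin a) (Fin a) ℝ}
    (hA : entriesIn (U : Set ℝ) A) (k : ℕ) : entriesIn (U : Set ℝ) (A ^ k) := by
  induction k with
  | zero => rw [pow_zero]; exact entriesIn_one
  | succ k ih => rw [pow_succ]; exact entriesIn_mul ih hA

lemma shiftEquivToScalar_of_isPrincipalIdealRing (U : Subring ℝ) [IsPrincipalIdealRing U] {N : ℕ}
    {A : Matrix (Fin N) (Fin N) ℝ} (hAU : entriesIn (U : Set ℝ) A) {lam : ℝ} (hlam : lam ≠ 0)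
    {r l : Fin N → ℝ} (h : EvRankOne lam A r l) : ShiftEquivToScalar (U : Set ℝ) A lam := by
  obtain ⟨k, hk, hpow⟩ := h.pow
  have happ : ∀ i j, (A ^ k) i j = lam ^ k * (r i * l j) := by
    intro i j
    rw [hpow, Matrix.smul_apply, Matrix.vecMulVec_apply, smul_eq_mul]
  obtain ⟨i₀, hi₀⟩ : ∃ i, l i * r i ≠ 0 := by
    by_contra! h0
    have := h.dot
    simp [dotProduct, h0] at this
  have hl₀ := left_ne_zero_of_mul hi₀
  have hr₀ := right_ne_zero_of_mul hi₀
  have hUk := entriesIn_pow hAU k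
  let w : Fin N → U := fun j => ⟨(A ^ k) i₀ j, hUk i₀ j⟩
  obtain ⟨g, hg⟩ := (IsPrincipalIdealRing.principal (Ideal.span (Set.range w))).principal
  have hgmem : g ∈ Ideal.span (Set.range w) := by
    rw [hg]; exact Submodule.mem_span_singleton_self g
  obtain ⟨c, hc⟩ := (Submodule.mem_span_range_iff_exists_fun U).1 hgmem
  have hw : ∀ j, ∃ s : U, s * g = w j := by
    intro j
    have : w j ∈ Ideal.span (Set.range w) := Ideal.subset_span ⟨j, rfl⟩
    rw [hg] at this
    exact Submodule.mem_span_singleton.1 this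
  choose s hs using hw
  have hsg : ∀ j, (s j : ℝ) * g = lam ^ k * (r i₀ * l j) := fun j => by
    rw [← happ]; exact congrArg Subtype.val (hs j)
  have hc' : ∑ j, (c j : ℝ) * (lam ^ k * (r i₀ * l j)) = g := by
    have := congrArg Subtype.val hc
    rw [← this]
    push_cast
    simp [w, happ]
  have hg0 : (g : ℝ) ≠ 0 := by
    intro h0
    have := hsg i₀
    rw [h0, mul_zero] at this
    exact mul_ne_zero (pow_ne_zero k hlam) (mul_ne_zero hr₀ hl₀) this.symm
  have hs' : ∀ j, (s j : ℝ) = lam ^ k * r i₀ / g * l j := fun j => by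
    rw [div_mul_eq_mul_div, eq_div_iff hg0, hsg, mul_assoc]
  have hR : ∀ i, ∑ j, (A ^ k) i j * c j = g / r i₀ * r i := by
    intro i
    rw [← hc', Finset.sum_div, Finset.sum_mul]
    refine Finset.sum_congr rfl fun j _ => ?_
    rw [happ]
    field_simp
  have hlk : lam ^ k ≠ 0 := pow_ne_zero k hlam
  have hdot : ∑ i, l i * r i = 1 := h.dot
  refine ⟨k, Matrix.of fun i _ => g / r i₀ * r i, Matrix.of fun _ j => (s j : ℝ), hk, ?_, ?_,
    ?_, ?_, ?_, ?_⟩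
  · intro i _
    rw [Matrix.of_apply, ← hR]
    exact U.sum_mem fun j _ => U.mul_mem (hUk i j) (c j).2
  · intro _ j
    exact (s j).2
  · ext i j
    rw [happ, Matrix.mul_apply]
    simp only [Matrix.of_apply, Finset.univ_unique, Finset.sum_const, Finset.card_singleton,
      one_smul, hs']
    field_simp
  · rw [scalar_one_eq_smul_one, _root_.smul_pow, one_pow]
    ext i j
    rw [Matrix.mul_apply]
    simp only [Matrix.of_apply, hs', Matrix.smul_apply, Subsingleton.elim i j, Matrix.one_apply_eq,
      smul_eq_mul, mul_one]
    have : ∀ x, lam ^ k * r i₀ / g * l x * (g / r i₀ * r x) = lam ^ k * (l x * r x) := by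
      intro x
      field_simp
    simp only [this]
    rw [← Finset.mul_sum, hdot, mul_one]
  · refine Eq.trans ?_ (mul_scalar_one _ _).symm
    ext i j
    have := congrFun h.right i
    simp only [Matrix.mulVec, dotProduct, Pi.smul_apply, smul_eq_mul] at this
    simp only [Matrix.mul_apply, Matrix.of_apply, Matrix.smul_apply, smul_eq_mul]
    rw [mul_left_comm, ← this, Finset.mul_sum]
    exact Finset.sum_congr rfl fun x _ => by ring
  · refine Eq.trans ?_ (scalar_one_mul _ _).symm
    ext i j
    have := congrFun h.left j
    simp only [Matrix.vecMul, dotProduct, Pi.smul_apply, smul_eq_mul] at this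
    simp only [Matrix.mul_apply, Matrix.of_apply, Matrix.smul_apply, smul_eq_mul, hs']
    rw [mul_left_comm, ← this, Finset.mul_sum]
    exact Finset.sum_congr rfl fun x _ => by ring

/-- The nonnegative elements of `U`. -/
def nonnegPart (U : Subring ℝ) : Set ℝ := {x : ℝ | x ∈ U ∧ 0 ≤ x}

lemma SSE.exists_evRankOne {S : Set ℝ} {lam : ℝ} (hlam : lam ≠ 0)
    {p q : (n : ℕ) × Matrix (Fin n) (Fin n) ℝ} (h : SSE S p q)
    (hp : ∃ r l, EvRankOne lam p.2 r l) : ∃ r l, EvRankOne lam q.2 r l := by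
  induction h with
  | refl => exact hp
  | tail _ h ih =>
    obtain ⟨R, S', -, -, h1, h2⟩ := h
    obtain ⟨r, l, hrl⟩ := ih
    exact ⟨_, _, h2 ▸ hrl.comm hlam h1⟩

lemma exists_mem_of_eventually_pos {U : Subring ℝ} (hU : Dense (U : Set ℝ)) {p : ℝ → Prop}
    (h : ∀ᶠ x in nhdsWithin 0 (Set.Ioi 0), p x) : ∃ a ∈ U, 0 < a ∧ p a := by
  obtain ⟨u, hu, hsub⟩ := mem_nhdsGT_iff_exists_Ioo_subset.1 h
  obtain ⟨a, ha, ha1⟩ := hU.exists_between hu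
  exact ⟨a, ha, ha1.1, hsub ha1⟩

lemma mul_nonneg_entries {a b c : ℕ} {A : Matrix (Fin a) (Fin b) ℝ} {B : Matrix (Fin b) (Fin c) ℝ}
    (hA : ∀ i j, 0 ≤ A i j) (hB : ∀ i j, 0 ≤ B i j) (i j) : 0 ≤ (A * B) i j := by
  rw [Matrix.mul_apply]
  exact Finset.sum_nonneg fun k _ => mul_nonneg (hA i k) (hB k j)

lemma mul_pos_entry {a b c : ℕ} {A : Matrix (Fin a) (Fin b) ℝ} {B : Matrix (Fin b) (Fin c) ℝ}
    (hA : ∀ i j, 0 ≤ A i j) (hB : ∀ i j, 0 ≤ B i j) {i : Fin a} {j : Fin c} (k : Fin b)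
    (h1 : 0 < A i k) (h2 : 0 < B k j) : 0 < (A * B) i j :=
  Finset.sum_pos' (fun k _ => mul_nonneg (hA i k) (hB k j)) ⟨k, Finset.mem_univ k, mul_pos h1 h2⟩

lemma pow_nonneg_entries {a : ℕ} {A : Matrix (Fin a) (Fin a) ℝ} (hA : ∀ i j, 0 ≤ A i j) (k : ℕ) :
    ∀ i j, 0 ≤ (A ^ k) i j := by
  induction k with
  | zero => intro i j; rw [pow_zero, Matrix.one_apply]; positivity
  | succ k ih => rw [pow_succ]; exact mul_nonneg_entries ih hA

lemma pow_pos_entries {a : ℕ} {A : Matrix (Fin a) (Fin a) ℝ} (hA : ∀ i j, 0 < A i j) {k : ℕ}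
    (hk : 1 ≤ k) : ∀ i j, 0 < (A ^ k) i j := by
  induction k, hk using Nat.le_induction with
  | base => simpa using hA
  | succ k hk ih =>
    intro i j
    rw [pow_succ]
    exact mul_pos_entry (fun i j => (ih i j).le) (fun i j => (hA i j).le) i (ih i i) (hA i j)

lemma mul_pow_succ {n m : ℕ} (R : Matrix (Fin n) (Fin m) ℝ) (S : Matrix (Fin m) (Fin n) ℝ)
    (k : ℕ) : (S * R) ^ (k + 1) = S * (R * S) ^ k * R := by
  induction k with
  | zero => simp
  | succ k ih => rw [pow_succ, ih, pow_succ (R * S)]; simp only [Matrix.mul_assoc]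

lemma pow_pos_swap {n m : ℕ} {R : Matrix (Fin n) (Fin m) ℝ} {S : Matrix (Fin m) (Fin n) ℝ}
    (hR : ∀ i j, 0 ≤ R i j) (hS : ∀ i j, 0 ≤ S i j) (hR' : ∀ j, ∃ i, 0 < R i j)
    (hS' : ∀ i, ∃ j, 0 < S i j) {k : ℕ} (hpos : ∀ i j, 0 < ((R * S) ^ k) i j) (i j) :
    0 < ((S * R) ^ (k + 1)) i j := by
  rw [mul_pow_succ]
  obtain ⟨x, hx⟩ := hR' j
  obtain ⟨y, hy⟩ := hS' i
  exact mul_pos_entry (mul_nonneg_entries hS fun i j => (hpos i j).le) hR x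
    (mul_pos_entry hS (fun i j => (hpos i j).le) y hy (hpos y x)) hx

lemma row_pow_pos {n : ℕ} {A : Matrix (Fin n) (Fin n) ℝ} (hA : ∀ i j, 0 ≤ A i j)
    (h : ∀ i, ∃ j, 0 < A i j) (k : ℕ) : ∀ i, ∃ j, 0 < (A ^ k) i j := by
  induction k with
  | zero => exact fun i => ⟨i, by simp⟩
  | succ k ih =>
    intro i
    obtain ⟨j, hj⟩ := h i
    obtain ⟨x, hx⟩ := ih j
    exact ⟨x, by rw [pow_succ']; exact mul_pos_entry hA (pow_nonneg_entries hA k) j hj hx⟩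

lemma col_pow_pos {n : ℕ} {A : Matrix (Fin n) (Fin n) ℝ} (hA : ∀ i j, 0 ≤ A i j)
    (h : ∀ j, ∃ i, 0 < A i j) (k : ℕ) : ∀ j, ∃ i, 0 < (A ^ k) i j := by
  induction k with
  | zero => exact fun i => ⟨i, by simp⟩
  | succ k ih =>
    intro i
    obtain ⟨j, hj⟩ := h i
    obtain ⟨x, hx⟩ := ih j
    exact ⟨x, by rw [pow_succ]; exact mul_pos_entry (pow_nonneg_entries hA k) hA j hx hj⟩

lemma exists_sse_pow_pos {U : Subring ℝ} {lam : ℝ} (hlam : lam ≠ 0) {n : ℕ}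
    (A : Matrix (Fin n) (Fin n) ℝ) (hA : entriesIn (nonnegPart U) A)
    (hev : ∃ r l, EvRankOne lam A r l) :
    ∃ (m : ℕ) (B : Matrix (Fin m) (Fin m) ℝ), SSE (nonnegPart U) ⟨n, A⟩ ⟨m, B⟩ ∧
      entriesIn (nonnegPart U) B ∧ ∃ k, 1 ≤ k ∧ ∀ i j, 0 < (B ^ k) i j := by
  induction n with
  | zero =>
    obtain ⟨r, l, h⟩ := hev
    exact (IsEmpty.false h.nonempty.some).elim
  | succ n ih =>
    have hone : ∀ i j : Fin (n + 1), (1 : Matrix _ _ ℝ) i j ∈ nonnegPart U := by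
      intro i j
      rw [Matrix.one_apply]
      split_ifs
      exacts [⟨U.one_mem, zero_le_one⟩, ⟨U.zero_mem, le_rfl⟩]
    have step : ∀ i : Fin (n + 1),
        ESSE (nonnegPart U) ⟨n + 1, A⟩ ⟨n, A.submatrix i.succAbove i.succAbove⟩ →
        ∃ (m : ℕ) (B : Matrix (Fin m) (Fin m) ℝ), SSE (nonnegPart U) ⟨n + 1, A⟩ ⟨m, B⟩ ∧
          entriesIn (nonnegPart U) B ∧ ∃ k, 1 ≤ k ∧ ∀ i j, 0 < (B ^ k) i j := by
      intro i h
      have h1 : SSE (nonnegPart U) ⟨n + 1, A⟩ ⟨n, A.submatrix i.succAbove i.succAbove⟩ :=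
        Relation.ReflTransGen.single h
      obtain ⟨m, B, hB, hB'⟩ := ih (A.submatrix i.succAbove i.succAbove) (fun _ _ => hA _ _)
        (h1.exists_evRankOne hlam hev)
      exact ⟨m, B, h1.trans hB, hB'⟩
    by_cases hrow : ∃ i, ∀ j, A i j = 0
    · obtain ⟨i, hi⟩ := hrow
      refine step i ⟨(1 : Matrix _ _ ℝ).submatrix id i.succAbove, A.submatrix i.succAbove id,
        fun _ _ => hone _ _, fun _ _ => hA _ _, ?_, ?_⟩
      · ext a b
        obtain rfl | ⟨c, rfl⟩ := Fin.eq_self_or_eq_succAbove i a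
        · simp [Matrix.mul_apply, hi, (Fin.succAbove_ne _ _).symm]
        · simp [Matrix.mul_apply, Matrix.one_apply]
      · ext a b
        simp [Matrix.mul_apply, Matrix.one_apply]
    by_cases hcol : ∃ j, ∀ i, A i j = 0
    · obtain ⟨i, hi⟩ := hcol
      refine step i ⟨A.submatrix id i.succAbove, (1 : Matrix _ _ ℝ).submatrix i.succAbove id,
        fun _ _ => hA _ _, fun _ _ => hone _ _, ?_, ?_⟩
      · ext a b
        obtain rfl | ⟨c, rfl⟩ := Fin.eq_self_or_eq_succAbove i b
        · simp [Matrix.mul_apply, hi, Fin.succAbove_ne]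
        · simp [Matrix.mul_apply, Matrix.one_apply]
      · ext a b
        simp [Matrix.mul_apply, Matrix.one_apply]
    push Not at hrow hcol
    have hA0 : ∀ i j, 0 ≤ A i j := fun i j => (hA i j).2
    obtain ⟨r, l, h⟩ := hev
    obtain ⟨k, hk, hpow⟩ := h.pow
    have happ : ∀ i j, (A ^ k) i j = lam ^ k * (r i * l j) := by
      intro i j
      rw [hpow, Matrix.smul_apply, Matrix.vecMulVec_apply, smul_eq_mul]
    refine ⟨n + 1, A, Relation.ReflTransGen.refl, hA, k, hk, fun i j => ?_⟩
    refine lt_of_le_of_ne (pow_nonneg_entries hA0 k i j) ?_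
    obtain ⟨x, hx⟩ := row_pow_pos hA0 (fun i => (hrow i).imp fun j hj => (hA0 i j).lt_of_ne' hj) k i
    obtain ⟨y, hy⟩ := col_pow_pos hA0 (fun i => (hcol i).imp fun j hj => (hA0 j i).lt_of_ne' hj) k j
    rw [happ] at hx hy ⊢
    have h1 := right_ne_zero_of_mul hx.ne'
    have h2 := right_ne_zero_of_mul hy.ne'
    exact (mul_ne_zero (pow_ne_zero k hlam)
      (mul_ne_zero (left_ne_zero_of_mul h1) (right_ne_zero_of_mul h2))).symm

lemma exists_pos_of_mul_pos {a b c : ℕ} {A : Matrix (Fin a) (Fin b) ℝ}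
    {B : Matrix (Fin b) (Fin c) ℝ} (hA : ∀ i j, 0 ≤ A i j) {i : Fin a}
    {j : Fin c} (h : 0 < (A * B) i j) : ∃ k, 0 < A i k ∧ 0 < B k j := by
  by_contra! h0
  rw [Matrix.mul_apply] at h
  refine h.not_ge (Finset.sum_nonpos fun k _ => ?_)
  rcases (hA i k).eq_or_lt with h1 | h1
  · rw [← h1, zero_mul]
  · exact mul_nonpos_of_nonneg_of_nonpos h1.le (h0 k h1)

lemma exists_sse_full_row {U : Subring ℝ} (hU : Dense (U : Set ℝ)) (d : ℕ) {n : ℕ}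
    (A : Matrix (Fin n) (Fin n) ℝ) (hA : entriesIn (nonnegPart U) A) {k : ℕ} (hk : 1 ≤ k)
    (hpos : ∀ i j, 0 < (A ^ k) i j) (p : Fin n) (hp : 0 < A p p)
    (hd : (Finset.univ.filter fun j => ¬ 0 < A p j).card ≤ d) :
    ∃ (m : ℕ) (B : Matrix (Fin m) (Fin m) ℝ), SSE (nonnegPart U) ⟨n, A⟩ ⟨m, B⟩ ∧
      entriesIn (nonnegPart U) B ∧ (∃ k, 1 ≤ k ∧ ∀ i j, 0 < (B ^ k) i j) ∧
      ∃ q, ∀ j, 0 < B q j := by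
  induction d generalizing n k with
  | zero =>
    refine ⟨n, A, Relation.ReflTransGen.refl, hA, ⟨k, hk, hpos⟩, p, fun j => ?_⟩
    by_contra hj
    exact hj (by simpa using Finset.filter_eq_empty_iff.1 (Finset.card_eq_zero.1 (Nat.le_zero.1 hd)) (Finset.mem_univ j))
  | succ d ih =>
    have hA0 : ∀ i j, 0 ≤ A i j := fun i j => (hA i j).2
    by_cases hfull : ∀ j, 0 < A p j
    · exact ⟨n, A, Relation.ReflTransGen.refl, hA, ⟨k, hk, hpos⟩, p, hfull⟩
    obtain ⟨i₀, j₀, hi₀, hj₀, hij⟩ : ∃ i j, 0 < A p i ∧ ¬ 0 < A p j ∧ 0 < A i j := by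
      by_contra! h0
      obtain ⟨j, hj⟩ := not_forall.1 hfull
      have : ∀ k, 1 ≤ k → ∀ j, ¬ 0 < A p j → ¬ 0 < (A ^ k) p j := by
        intro k hk
        induction k, hk using Nat.le_induction with
        | base => simp
        | succ k hk ih =>
          intro j hj h1
          rw [pow_succ] at h1
          obtain ⟨x, hx, hx'⟩ := exists_pos_of_mul_pos (pow_nonneg_entries hA0 k) h1
          by_cases hpx : 0 < A p x
          · exact (h0 x j hpx (not_lt.1 hj)).not_gt hx'
          · exact ih x hpx hx
      exact this k hk j hj (hpos p j)
    have hy : ∀ j, ∃ y ∈ nonnegPart U, (0 < A p j → 0 < y ∧ y < A p j) ∧ y ≤ A p j := by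
      intro j
      by_cases hj : 0 < A p j
      · obtain ⟨y, hyU, hy⟩ := hU.exists_between hj
        exact ⟨y, ⟨hyU, hy.1.le⟩, fun _ => hy, hy.2.le⟩
      · exact ⟨0, ⟨U.zero_mem, le_rfl⟩, fun h => absurd h hj, hA0 p j⟩
    choose y hyU hy hy' using hy
    let R : Matrix (Fin n) (Fin (n + 1)) ℝ := Matrix.of fun i =>
      Fin.cons (if i = p then 1 else 0) fun j => A i j - if i = p then y j else 0
    let S : Matrix (Fin (n + 1)) (Fin n) ℝ := Matrix.of
      (Fin.cons y fun i => Pi.single i 1)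
    have hR0 : ∀ i, R i 0 = if i = p then 1 else 0 := fun i => rfl
    have hRs : ∀ i (j : Fin n), R i j.succ = A i j - if i = p then y j else 0 := fun i j => rfl
    have hS0 : ∀ j, S 0 j = y j := fun j => rfl
    have hSs : ∀ (i : Fin n) j, S i.succ j = (Pi.single i 1 : Fin n → ℝ) j := fun i j => rfl
    have hRS : A = R * S := by
      ext i j
      rw [Matrix.mul_apply, Fin.sum_univ_succ]
      simp only [hR0, hRs, hS0, hSs, Pi.single_apply]
      simp
    have hRU : entriesIn (nonnegPart U) R := by
      intro i j
      cases j using Fin.cases with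
      | zero =>
        rw [hR0]
        split_ifs
        exacts [⟨U.one_mem, zero_le_one⟩, ⟨U.zero_mem, le_rfl⟩]
      | succ j =>
        rw [hRs]
        split_ifs with h
        · subst h
          exact ⟨U.sub_mem (hA i j).1 (hyU j).1, sub_nonneg.2 (hy' j)⟩
        · rw [sub_zero]; exact hA i j
    have hSU : entriesIn (nonnegPart U) S := by
      intro i j
      cases i using Fin.cases with
      | zero => exact hyU j
      | succ i =>
        rw [hSs, Pi.single_apply]
        split_ifs
        exacts [⟨U.one_mem, zero_le_one⟩, ⟨U.zero_mem, le_rfl⟩]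
    have hRn : ∀ i j, 0 ≤ R i j := fun i j => (hRU i j).2
    have hSn : ∀ i j, 0 ≤ S i j := fun i j => (hSU i j).2
    have hBU : entriesIn (nonnegPart U) (S * R) := fun i j =>
      ⟨entriesIn_mul (fun i j => (hSU i j).1) (fun i j => (hRU i j).1) i j,
        mul_nonneg_entries hSn hRn i j⟩
    have hRp : ∀ i j, 0 < A i j → 0 < R i j.succ := by
      intro i j hij
      rw [hRs]
      split_ifs with h
      · subst h
        exact sub_pos.2 (hy j hij).2
      · rwa [sub_zero]
    have hRcol : ∀ j, ∃ i, 0 < R i j := by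
      intro j
      cases j using Fin.cases with
      | zero => exact ⟨p, by rw [hR0, if_pos rfl]; exact one_pos⟩
      | succ j =>
        obtain ⟨k, rfl⟩ : ∃ x, k = x + 1 := ⟨k - 1, by omega⟩
        have h1 := hpos p j
        rw [pow_succ] at h1
        obtain ⟨x, -, hx⟩ := exists_pos_of_mul_pos (pow_nonneg_entries hA0 k) h1
        exact ⟨x, hRp x j hx⟩
    have hSrow : ∀ i, ∃ j, 0 < S i j := by
      intro i
      cases i using Fin.cases with
      | zero => exact ⟨p, (hy p hp).1⟩
      | succ i => exact ⟨i, by rw [hSs]; simp⟩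
    have hB0 : 0 < (S * R) 0 0 := by
      exact mul_pos_entry hSn hRn p (show 0 < S 0 p from (hy p hp).1) (by rw [hR0, if_pos rfl]; exact one_pos)
    have hcard : (Finset.univ.filter fun j => ¬ 0 < (S * R) 0 j).card ≤ d := by
      have hsub : (Finset.univ.filter fun j => ¬ 0 < (S * R) 0 j) ⊆
          ((Finset.univ.filter fun j => ¬ 0 < A p j).erase j₀).map (Fin.succEmb n) := by
        intro j hj
        replace hj := (Finset.mem_filter.1 hj).2
        cases j using Fin.cases with
        | zero =>
          exact absurd (mul_pos_entry hSn hRn p (show 0 < S 0 p from (hy p hp).1)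
            (by rw [hR0, if_pos rfl]; exact one_pos)) hj
        | succ j =>
          refine Finset.mem_map.2 ⟨j, Finset.mem_erase.2 ⟨?_, Finset.mem_filter.2
            ⟨Finset.mem_univ j, fun h => ?_⟩⟩, rfl⟩
          · rintro rfl
            exact hj (mul_pos_entry hSn hRn i₀ (hy i₀ hi₀).1 (hRp _ _ hij))
          · exact hj (mul_pos_entry hSn hRn p (hy p hp).1 (hRp _ _ h))
      have h1 := Finset.card_le_card hsub
      rw [Finset.card_map, Finset.card_erase_of_mem
        (Finset.mem_filter.2 ⟨Finset.mem_univ j₀, hj₀⟩)] at h1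
      omega
    obtain ⟨m, B, hB, hB'⟩ := ih (S * R) hBU (k := k + 1) (by omega)
      (pow_pos_swap hRn hSn hRcol hSrow (hRS ▸ hpos)) 0 hB0 hcard
    exact ⟨m, B, Relation.ReflTransGen.head ⟨R, S, hRU, hSU, hRS, rfl⟩ hB, hB'⟩

open scoped Classical in
lemma exists_sse_pos_of_full_row {U : Subring ℝ} (hU : Dense (U : Set ℝ)) (d : ℕ) {n : ℕ}
    (A : Matrix (Fin n) (Fin n) ℝ) (hA : entriesIn (nonnegPart U) A) {k : ℕ} (hk : 1 ≤ k)
    (hpos : ∀ i j, 0 < (A ^ k) i j) (hfull : ∃ q, ∀ j, 0 < A q j)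
    (hd : (Finset.univ.filter fun i => ¬ ∀ j, 0 < A i j).card ≤ d) :
    ∃ (m : ℕ) (B : Matrix (Fin m) (Fin m) ℝ), SSE (nonnegPart U) ⟨n, A⟩ ⟨m, B⟩ ∧
      entriesIn (U : Set ℝ) B ∧ ∀ i j, 0 < B i j := by
  have hA0 : ∀ i j, 0 ≤ A i j := fun i j => (hA i j).2
  induction d generalizing k A with
  | zero =>
    refine ⟨n, A, Relation.ReflTransGen.refl, fun i j => (hA i j).1, fun i => ?_⟩
    by_contra hj
    exact hj (by simpa using Finset.filter_eq_empty_iff.1 (Finset.card_eq_zero.1 (Nat.le_zero.1 hd)) (Finset.mem_univ i))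
  | succ d ih =>
    by_cases hall : ∀ i j, 0 < A i j
    · exact ⟨n, A, Relation.ReflTransGen.refl, fun i j => (hA i j).1, hall⟩
    obtain ⟨a, i, ha, hi, hai⟩ : ∃ a i, (¬ ∀ j, 0 < A a j) ∧ (∀ j, 0 < A i j) ∧ 0 < A a i := by
      by_contra! h0
      obtain ⟨a, ha⟩ := not_forall.1 hall
      obtain ⟨q, hq⟩ := hfull
      have : ∀ k, ∀ a, (¬ ∀ j, 0 < A a j) → ¬ 0 < (A ^ k) a q := by
        intro k
        induction k with
        | zero =>
          intro a ha
          rw [pow_zero, Matrix.one_apply_ne]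
          · simp
          · rintro rfl
            exact ha hq
        | succ k ih =>
          intro a ha h1
          rw [pow_succ'] at h1
          obtain ⟨x, hx, hx'⟩ := exists_pos_of_mul_pos hA0 h1
          by_cases hpx : ∀ j, 0 < A x j
          · exact (h0 a x (by simpa using ha) hpx).not_gt hx
          · exact ih x hpx hx'
      exact this k a ha (hpos a q)
    obtain ⟨e, heU, he, hsmall⟩ := exists_mem_of_eventually_pos hU
      (p := fun e => ∀ j, 0 < A i j - e * ∑ x ∈ Finset.univ.erase i, A x j) (by
        refine Filter.eventually_all.2 fun j => ?_
        refine Filter.Eventually.filter_mono nhdsWithin_le_nhds ?_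
        exact (Continuous.tendsto' (by fun_prop) _ (A i j) (by simp)).eventually_const_lt (hi j))
    let R : Matrix (Fin n) (Fin n) ℝ := Matrix.of fun x y =>
      if x = y then 1 else if x = i then e else 0
    let S : Matrix (Fin n) (Fin n) ℝ := Matrix.of fun x y =>
      if x = i then A i y - e * ∑ z ∈ Finset.univ.erase i, A z y else A x y
    have hR : ∀ x y, R x y = if x = y then 1 else if x = i then e else 0 := fun _ _ => rfl
    have hS : ∀ x y, S x y =
      if x = i then A i y - e * ∑ z ∈ Finset.univ.erase i, A z y else A x y := fun _ _ => rfl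
    have hRS : A = R * S := by
      ext x y
      rw [Matrix.mul_apply]
      by_cases hx : x = i
      · subst hx
        rw [← Finset.add_sum_erase _ _ (Finset.mem_univ x), Finset.sum_congr rfl
          (g := fun z => e * A z y)]
        · rw [← Finset.mul_sum, hR, hS]
          simp
        · intro z hz
          have := Finset.ne_of_mem_erase hz
          rw [hR, hS, if_neg this, if_neg this.symm, if_pos rfl]
      · rw [Finset.sum_eq_single x]
        · simp [hR, hS, hx]
        · intro z _ hz
          simp [hR, hx, hz.symm]
        · simp
    have hRU : entriesIn (nonnegPart U) R := by
      intro x y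
      rw [hR]
      split_ifs
      exacts [⟨U.one_mem, zero_le_one⟩, ⟨heU, he.le⟩, ⟨U.zero_mem, le_rfl⟩]
    have hSU : entriesIn (nonnegPart U) S := by
      intro x y
      rw [hS]
      split_ifs
      · exact ⟨U.sub_mem (hA i y).1 (U.mul_mem heU (U.sum_mem fun z _ => (hA z y).1)),
          (hsmall y).le⟩
      · exact hA x y
    have hRn : ∀ i j, 0 ≤ R i j := fun i j => (hRU i j).2
    have hSn : ∀ i j, 0 ≤ S i j := fun i j => (hSU i j).2
    have hBU : entriesIn (nonnegPart U) (S * R) := fun i j =>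
      ⟨entriesIn_mul (fun i j => (hSU i j).1) (fun i j => (hRU i j).1) i j,
        mul_nonneg_entries hSn hRn i j⟩
    have hSp : ∀ x y, 0 < A x y → 0 < S x y := by
      intro x y h
      rw [hS]
      split_ifs
      exacts [hsmall y, h]
    have hRd : ∀ x, 0 < R x x := by intro x; rw [hR, if_pos rfl]; exact one_pos
    have hBp : ∀ x y, 0 < A x y → 0 < (S * R) x y := fun x y h =>
      mul_pos_entry hSn hRn y (hSp x y h) (hRd y)
    have hBa : ∀ j, 0 < (S * R) a j := by
      intro j
      refine mul_pos_entry hSn hRn i (hSp a i hai) ?_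
      rw [hR, if_pos rfl]
      split_ifs
      exacts [one_pos, he]
    have hSrow : ∀ i, ∃ j, 0 < S i j := by
      intro x
      obtain ⟨k, rfl⟩ : ∃ x, k = x + 1 := ⟨k - 1, by omega⟩
      have h1 := hpos x x
      rw [pow_succ'] at h1
      obtain ⟨y, hy, -⟩ := exists_pos_of_mul_pos hA0 h1
      exact ⟨y, hSp x y hy⟩
    have hcard : (Finset.univ.filter fun x => ¬ ∀ j, 0 < (S * R) x j).card ≤ d := by
      have hsub : (Finset.univ.filter fun x => ¬ ∀ j, 0 < (S * R) x j) ⊆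
          (Finset.univ.filter fun x => ¬ ∀ j, 0 < A x j).erase a := by
        intro x hx
        replace hx := (Finset.mem_filter.1 hx).2
        refine Finset.mem_erase.2 ⟨?_, Finset.mem_filter.2
          ⟨Finset.mem_univ x, fun h => hx fun j => hBp x j (h j)⟩⟩
        rintro rfl
        exact hx hBa
      have h1 := Finset.card_le_card hsub
      rw [Finset.card_erase_of_mem (Finset.mem_filter.2 ⟨Finset.mem_univ a, ha⟩)] at h1
      omega
    obtain ⟨m, B, hB, hB'⟩ := ih (S * R) hBU (k := k + 1) (by omega)
      (pow_pos_swap hRn hSn (fun j => ⟨j, hRd j⟩) hSrow (hRS ▸ hpos)) ⟨a, hBa⟩ hcard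
      (fun i j => (hBU i j).2)
    exact ⟨m, B, Relation.ReflTransGen.head ⟨R, S, hRU, hSU, hRS, rfl⟩ hB, hB'⟩

lemma exists_sse_pos {U : Subring ℝ} (hU : Dense (U : Set ℝ)) {lam : ℝ} (hlam : lam ≠ 0) {n : ℕ}
    (A : Matrix (Fin n) (Fin n) ℝ) (hA : entriesIn (nonnegPart U) A)
    (hev : ∃ r l, EvRankOne lam A r l) :
    0 < lam ∧ ∃ (m : ℕ) (B : Matrix (Fin m) (Fin m) ℝ), SSE (nonnegPart U) ⟨n, A⟩ ⟨m, B⟩ ∧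
      entriesIn (U : Set ℝ) B ∧ ∀ i j, 0 < B i j := by
  have hlam0 : 0 < lam := by
    obtain ⟨r, l, h⟩ := hev
    refine lt_of_le_of_ne ?_ hlam.symm
    rw [← h.trace_eq]
    exact Finset.sum_nonneg fun i _ => (hA i i).2
  refine ⟨hlam0, ?_⟩
  obtain ⟨n₁, A₁, h₁, hA₁, k₁, hk₁, hpos₁⟩ := exists_sse_pow_pos hlam A hA hev
  obtain ⟨p, hp⟩ : ∃ p, 0 < A₁ p p := by
    obtain ⟨r, l, h⟩ := h₁.exists_evRankOne hlam hev
    by_contra! h0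
    have h1 : A₁.trace ≤ 0 := Finset.sum_nonpos fun i _ => h0 i
    rw [h.trace_eq] at h1
    exact h1.not_gt hlam0
  obtain ⟨n₂, A₂, h₂, hA₂, ⟨k₂, hk₂, hpos₂⟩, hq⟩ :=
    exists_sse_full_row hU _ A₁ hA₁ hk₁ hpos₁ p hp le_rfl
  obtain ⟨n₃, A₃, h₃, hA₃⟩ := exists_sse_pos_of_full_row hU _ A₂ hA₂ hk₂ hpos₂ hq le_rfl
  exact ⟨n₃, A₃, (h₁.trans h₂).trans h₃, hA₃⟩

open scoped MatrixOrder ComplexOrder in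
lemma exists_transpose_mul_self {m : ℕ} {Q : Matrix (Fin m) (Fin m) ℝ} (hQ : Qᵀ = Q)
    (hpos : ∀ x, x ≠ 0 → 0 < x ⬝ᵥ (Q *ᵥ x)) :
    ∃ C : (Matrix (Fin m) (Fin m) ℝ)ˣ, (C : Matrix (Fin m) (Fin m) ℝ)ᵀ * C = Q := by
  have hQ' : Q.PosDef := Matrix.PosDef.of_dotProduct_mulVec_pos
    (by rw [Matrix.IsHermitian, Matrix.conjTranspose_eq_transpose_of_trivial, hQ])
    (fun x hx => by simpa using hpos x hx)
  obtain ⟨C, hC⟩ := CStarAlgebra.nonneg_iff_eq_star_mul_self.mp hQ'.posSemidef.nonneg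
  rw [Matrix.star_eq_conjTranspose, Matrix.conjTranspose_eq_transpose_of_trivial] at hC
  have hdet : IsUnit C := by
    rw [Matrix.isUnit_iff_isUnit_det, isUnit_iff_ne_zero]
    intro h0
    have := hQ'.det_pos
    rw [hC, Matrix.det_mul, h0, mul_zero] at this
    exact lt_irrefl _ this
  exact ⟨hdet.unit, hC.symm⟩

/-- A symmetric orthogonal matrix exchanging two given unit vectors. -/
lemma exists_reflection {m : ℕ} {u v : Fin m → ℝ} (hu : u ⬝ᵥ u = 1) (hv : v ⬝ᵥ v = 1) :
    ∃ O : Matrix (Fin m) (Fin m) ℝ, Oᵀ = O ∧ O * O = 1 ∧ O *ᵥ v = u := by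
  set w := u - v with hw
  set c := 2 / (w ⬝ᵥ w) with hc
  have hww : w ⬝ᵥ w = 2 - 2 * (w ⬝ᵥ v + 1) := by
    rw [hw]
    simp only [sub_dotProduct, dotProduct_sub, hu, hv, dotProduct_comm v u]
    ring
  refine ⟨1 - c • vecMulVec w w, ?_, ?_, ?_⟩
  · simp [Matrix.transpose_vecMulVec]
  · have : c * (c * (w ⬝ᵥ w)) = 2 * c := by
      by_cases h0 : w ⬝ᵥ w = 0
      · simp [hc, h0]
      · rw [hc]; field_simp
    rw [sub_mul, mul_sub, mul_sub, one_mul, mul_one, one_mul, smul_mul_smul_comm,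
      Matrix.vecMulVec_mul_vecMulVec, Matrix.vecMulVec_smul, smul_smul, mul_assoc, this, two_mul,
      add_smul]
    abel
  · rw [Matrix.sub_mulVec, Matrix.one_mulVec, Matrix.smul_mulVec, Matrix.vecMulVec_mulVec]
    by_cases h0 : w ⬝ᵥ w = 0
    · have : w = 0 := dotProduct_self_eq_zero.1 h0
      rw [this]
      simp [sub_eq_zero.1 (hw.symm.trans this)]
    · have h1 : c * (w ⬝ᵥ v) = -1 := by
        rw [hc, div_mul_eq_mul_div, div_eq_iff h0, hww]; ring
      have : c • MulOpposite.op (w ⬝ᵥ v) • w = -w := by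
        rw [op_smul_eq_smul, smul_smul, h1, neg_one_smul]
      rw [this, hw]
      abel

lemma sq_le_dotProduct_self {m : ℕ} (x : Fin m → ℝ) (i : Fin m) : x i ^ 2 ≤ x ⬝ᵥ x := by
  rw [dotProduct, sq]
  exact Finset.single_le_sum (f := fun i => x i * x i) (fun i _ => mul_self_nonneg (x i))
    (Finset.mem_univ i)

lemma dotProduct_self_mulVec {n m : ℕ} (M : Matrix (Fin n) (Fin m) ℝ) (x : Fin m → ℝ) :
    (M *ᵥ x) ⬝ᵥ (M *ᵥ x) = x ⬝ᵥ ((Mᵀ * M) *ᵥ x) := by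
  rw [← Matrix.mulVec_mulVec, Matrix.dotProduct_mulVec x, Matrix.vecMul_transpose]

/-- A basis of `ℝᵐ` adapted to a pair of rectangular matrices `R`, `S` annihilated by a rank one
projection. -/
lemma exists_adapted_basis {n m : ℕ} {R : Matrix (Fin n) (Fin m) ℝ} {S : Matrix (Fin m) (Fin n) ℝ}
    {r l v : Fin m → ℝ} (hlr : l ⬝ᵥ r = 1) (hRr : R *ᵥ r = 0) (hlS : l ᵥ* S = 0)
    (hv : v ⬝ᵥ v = 1) {a b : ℝ} (ha : 0 < a) (hb : 0 < b) :
    ∃ Y : (Matrix (Fin m) (Fin m) ℝ)ˣ, l ᵥ* Y.val = v ∧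
      (Y⁻¹).val *ᵥ r = v ∧
      (∀ i j, b * (R * Y.val) i j ^ 2 ≤ 1) ∧
      ∀ i j, ((Y⁻¹).val * S) i j ^ 2 ≤
        b * ((R * S).col j ⬝ᵥ (R * S).col j) + a * (S.col j ⬝ᵥ S.col j) := by
  set T : Matrix (Fin m) (Fin m) ℝ := 1 - vecMulVec r l with hT
  set Q := vecMulVec l l + b • (Rᵀ * R) + a • (Tᵀ * T) with hQ
  have hTx : ∀ x, l ⬝ᵥ x = 0 → T *ᵥ x = x := by
    intro x hx
    rw [hT, Matrix.sub_mulVec, Matrix.one_mulVec, Matrix.vecMulVec_mulVec, hx]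
    simp
  have hTr : T *ᵥ r = 0 := by
    rw [hT, Matrix.sub_mulVec, Matrix.one_mulVec, Matrix.vecMulVec_mulVec, hlr]
    simp
  have hQx : ∀ x, Q *ᵥ x = (l ⬝ᵥ x) • l + b • (Rᵀ *ᵥ (R *ᵥ x)) + a • (Tᵀ *ᵥ (T *ᵥ x)) := by
    intro x
    rw [hQ, Matrix.add_mulVec, Matrix.add_mulVec, Matrix.vecMulVec_mulVec, op_smul_eq_smul,
      Matrix.smul_mulVec, Matrix.smul_mulVec, Matrix.mulVec_mulVec, Matrix.mulVec_mulVec]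
  have hquad : ∀ x, x ⬝ᵥ (Q *ᵥ x) =
      (l ⬝ᵥ x) ^ 2 + b * ((R *ᵥ x) ⬝ᵥ (R *ᵥ x)) + a * ((T *ᵥ x) ⬝ᵥ (T *ᵥ x)) := by
    intro x
    rw [hQx, dotProduct_self_mulVec, dotProduct_self_mulVec, ← Matrix.mulVec_mulVec,
      ← Matrix.mulVec_mulVec]
    simp only [dotProduct_add, dotProduct_smul, smul_eq_mul, dotProduct_comm x l]
    ring
  have hQs : Qᵀ = Q := by simp [hQ, Matrix.transpose_mul, Matrix.transpose_vecMulVec]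
  have hself : ∀ {k : ℕ} (x : Fin k → ℝ), 0 ≤ x ⬝ᵥ x := fun x =>
    Finset.sum_nonneg fun i _ => mul_self_nonneg (x i)
  have hQp : ∀ x, x ≠ 0 → 0 < x ⬝ᵥ (Q *ᵥ x) := by
    intro x hx
    rw [hquad]
    have h1 := mul_nonneg hb.le (hself (R *ᵥ x))
    have h2 := mul_nonneg ha.le (hself (T *ᵥ x))
    by_cases h0 : l ⬝ᵥ x = 0
    · rw [hTx x h0] at h2 ⊢
      have h3 : 0 < a * (x ⬝ᵥ x) :=
        mul_pos ha ((hself x).lt_of_ne fun h => hx (dotProduct_self_eq_zero.1 h.symm))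
      positivity
    · positivity
  obtain ⟨C, hC⟩ := exists_transpose_mul_self hQs hQp
  have hCx : ∀ x, (C.val *ᵥ x) ⬝ᵥ (C.val *ᵥ x) = x ⬝ᵥ (Q *ᵥ x) :=
    fun x => by rw [dotProduct_self_mulVec, hC]
  set u := C.val *ᵥ r with hu
  have hQr : Q *ᵥ r = l := by rw [hQx, hlr, hRr, hTr]; simp
  have huu : u ⬝ᵥ u = 1 := by rw [hu, hCx, hQr, dotProduct_comm, hlr]
  have huC : u ᵥ* C.val = l := by
    rw [← Matrix.mulVec_transpose, hu, Matrix.mulVec_mulVec, hC, hQr]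
  obtain ⟨O, hOt, hOO, hOv⟩ := exists_reflection huu hv
  have hOu : O *ᵥ u = v := by rw [← hOv, Matrix.mulVec_mulVec, hOO, Matrix.one_mulVec]
  let O' : (Matrix (Fin m) (Fin m) ℝ)ˣ := ⟨O, O, hOO, hOO⟩
  have hOx : ∀ x, (O *ᵥ x) ⬝ᵥ (O *ᵥ x) = x ⬝ᵥ x := fun x => by
    rw [dotProduct_self_mulVec, hOt, hOO, Matrix.one_mulVec]
  have hY : (C⁻¹ * O').val =
    (C⁻¹).val * O := rfl
  have hY' : ((C⁻¹ * O')⁻¹).val = O * C := by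
    rw [_root_.mul_inv_rev, inv_inv]; rfl
  refine ⟨C⁻¹ * O', ?_, ?_, ?_, ?_⟩
  · rw [hY, ← huC, Matrix.vecMul_vecMul, ← mul_assoc, Units.mul_inv, one_mul,
      ← Matrix.mulVec_transpose, hOt, hOu]
  · rw [hY', ← Matrix.mulVec_mulVec, ← hu, hOu]
  · intro i j
    set y := ((C⁻¹).val * O).col j with hy
    have h1 : C.val *ᵥ y = O *ᵥ Pi.single j 1 := by
      rw [hy, ← Matrix.mulVec_single_one, Matrix.mulVec_mulVec, ← mul_assoc, Units.mul_inv, one_mul]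
    have h2 : y ⬝ᵥ (Q *ᵥ y) = 1 := by
      rw [← hCx, h1, hOx]; simp
    have h3 : (R * ((C⁻¹).val * O)) i j = (R *ᵥ y) i := rfl
    rw [hY, h3]
    rw [hquad] at h2
    have h4 := mul_le_mul_of_nonneg_left (sq_le_dotProduct_self (R *ᵥ y) i) hb.le
    have h5 := mul_nonneg ha.le (hself (T *ᵥ y))
    nlinarith [sq_nonneg (l ⬝ᵥ y)]
  · intro i j
    set s := S.col j with hs
    have h1 : (O * C.val * S) i j = (O *ᵥ (C.val *ᵥ s)) i := by
      rw [Matrix.mulVec_mulVec]; rfl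
    have h2 : l ⬝ᵥ s = 0 := congrFun hlS j
    rw [hY', h1]
    refine (sq_le_dotProduct_self _ i).trans (le_of_eq ?_)
    rw [hOx, hCx, hquad, h2, hTx s h2]
    have h3 : R *ᵥ s = (R * S).col j := rfl
    rw [h3]
    ring

lemma exists_cone {n m : ℕ} {lam : ℝ} (hlam : 0 < lam) {r l : Fin n → ℝ} (hr : ∀ i, 0 < r i)
    (hl : ∀ i, 0 < l i) (hlr : l ⬝ᵥ r = 1) :
    ∃ ε > 0, ∀ (R : Matrix (Fin n) (Fin m) ℝ) (S : Matrix (Fin m) (Fin n) ℝ)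
      (E : Matrix (Fin n) (Fin n) ℝ), R * S = lam • vecMulVec r l + E → E *ᵥ r = 0 → l ᵥ* E = 0 →
      (∀ i j, |E i j| < ε) → ∃ Y : (Matrix (Fin m) (Fin m) ℝ)ˣ,
        (∀ i j, 0 < (R * Y.val) i j) ∧
        ∀ i j, 0 < ((Y⁻¹).val * S) i j := by
  rcases Nat.eq_zero_or_pos m with rfl | hm
  · exact ⟨1, one_pos, fun R S E _ _ _ _ => ⟨1, fun i j => j.elim0, fun i => i.elim0⟩⟩
  have hm' : (0 : ℝ) < m := by exact_mod_cast hm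
  set t : ℝ := (√m)⁻¹ with ht
  have ht0 : 0 < t := inv_pos.2 (Real.sqrt_pos.2 hm')
  have htt : m * (t * t) = 1 := by
    rw [ht, ← mul_inv, Real.mul_self_sqrt hm'.le, mul_inv_cancel₀ hm'.ne']
  obtain ⟨η, hη0, hη⟩ : ∃ η > 0, ∀ i, η < lam * r i * t := by
    have h : ∀ᶠ η : ℝ in nhdsWithin 0 (Set.Ioi 0), ∀ i, η < lam * r i * t := by
      refine Filter.eventually_all.2 fun i => ?_
      exact (gt_mem_nhds (mul_pos (mul_pos hlam (hr i)) ht0)).filter_mono nhdsWithin_le_nhds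
    obtain ⟨η, h1, h2⟩ := (h.and self_mem_nhdsWithin).exists
    exact ⟨η, h2, h1⟩
  set b := (η ^ 2)⁻¹ with hb
  have hb0 : 0 < b := inv_pos.2 (pow_pos hη0 2)
  obtain ⟨ε, hε0, hε⟩ : ∃ ε > 0, ∀ j, b * (n * (ε * ε)) < (l j * t) ^ 2 := by
    have h : ∀ᶠ ε : ℝ in nhdsWithin 0 (Set.Ioi 0), ∀ j, b * (n * (ε * ε)) < (l j * t) ^ 2 := by
      refine Filter.eventually_all.2 fun j => ?_
      have : Filter.Tendsto (fun ε : ℝ => b * (n * (ε * ε))) (nhds 0) (nhds 0) :=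
        Continuous.tendsto' (by fun_prop) _ _ (by simp)
      exact (this.eventually_lt_const (pow_pos (mul_pos (hl j) ht0) 2)).filter_mono
        nhdsWithin_le_nhds
    obtain ⟨η, h1, h2⟩ := (h.and self_mem_nhdsWithin).exists
    exact ⟨η, h2, h1⟩
  refine ⟨ε, hε0, fun R S E hRS hEr hlE hE => ?_⟩
  set r₁ := S *ᵥ r with hr₁
  set l₁ := lam⁻¹ • (l ᵥ* R) with hl₁
  have hRr : R *ᵥ r₁ = lam • r := by
    rw [hr₁, Matrix.mulVec_mulVec, hRS, Matrix.add_mulVec, hEr, Matrix.smul_mulVec,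
      Matrix.vecMulVec_mulVec, hlr]
    simp
  have hlS : l₁ ᵥ* S = l := by
    rw [hl₁, Matrix.smul_vecMul, Matrix.vecMul_vecMul, hRS, Matrix.vecMul_add, hlE, add_zero,
      Matrix.vecMul_smul, Matrix.vecMul_vecMulVec, hlr, one_smul, smul_smul,
      inv_mul_cancel₀ hlam.ne', one_smul]
  have hlr₁ : l₁ ⬝ᵥ r₁ = 1 := by rw [hr₁, Matrix.dotProduct_mulVec, hlS, hlr]
  set R' := R - lam • vecMulVec r l₁ with hR'
  set S' := S - vecMulVec r₁ l with hS'
  have hR'r : R' *ᵥ r₁ = 0 := by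
    rw [hR', Matrix.sub_mulVec, hRr, Matrix.smul_mulVec, Matrix.vecMulVec_mulVec, hlr₁]
    simp
  have hlS' : l₁ ᵥ* S' = 0 := by
    rw [hS', Matrix.vecMul_sub, hlS, Matrix.vecMul_vecMulVec, hlr₁, one_smul, sub_self]
  have hRS' : R' * S' = E := by
    rw [hS', Matrix.mul_sub, Matrix.mul_vecMulVec, hR'r, Matrix.zero_vecMulVec, sub_zero, hR',
      Matrix.sub_mul, hRS, Matrix.smul_mul, Matrix.vecMulVec_mul, hlS, add_sub_cancel_left]
  obtain ⟨a, ha0, ha⟩ : ∃ a > 0, ∀ j,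
      b * (n * (ε * ε)) + a * (S'.col j ⬝ᵥ S'.col j) < (l j * t) ^ 2 := by
    have h : ∀ᶠ a : ℝ in nhdsWithin 0 (Set.Ioi 0), ∀ j,
        b * (n * (ε * ε)) + a * (S'.col j ⬝ᵥ S'.col j) < (l j * t) ^ 2 := by
      refine Filter.eventually_all.2 fun j => ?_
      have : Filter.Tendsto (fun a : ℝ => b * (n * (ε * ε)) + a * (S'.col j ⬝ᵥ S'.col j))
          (nhds 0) (nhds (b * (n * (ε * ε)))) :=
        Continuous.tendsto' (by fun_prop) _ _ (by simp)
      exact (this.eventually_lt_const (hε j)).filter_mono nhdsWithin_le_nhds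
    obtain ⟨η, h1, h2⟩ := (h.and self_mem_nhdsWithin).exists
    exact ⟨η, h2, h1⟩
  obtain ⟨Y, hY1, hY2, hY3, hY4⟩ := exists_adapted_basis (v := fun _ => t) hlr₁ hR'r hlS'
    (by simpa [dotProduct] using htt) ha0 hb0
  refine ⟨Y, fun i j => ?_, fun i j => ?_⟩
  · have h1 : R * Y.val = lam • vecMulVec r (fun _ => t) + R' * Y.val := by
      rw [hR', Matrix.sub_mul, Matrix.smul_mul, Matrix.vecMulVec_mul, hY1, add_sub_cancel]
    have h2 := hY3 i j
    rw [hb, inv_mul_le_iff₀ (pow_pos hη0 2), mul_one] at h2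
    have h3 := (abs_le_of_sq_le_sq' h2 hη0.le).1
    rw [h1, Matrix.add_apply, Matrix.smul_apply, Matrix.vecMulVec_apply, smul_eq_mul]
    linarith [hη i]
  · have h1 : (Y⁻¹).val * S = vecMulVec (fun _ => t) l + (Y⁻¹).val * S' := by
      rw [hS', Matrix.mul_sub, Matrix.mul_vecMulVec, hY2, add_sub_cancel]
    have h2 := hY4 i j
    rw [hRS'] at h2
    have h3 : E.col j ⬝ᵥ E.col j ≤ n * (ε * ε) := by
      have : ∀ i ∈ Finset.univ, E.col j i * E.col j i ≤ ε * ε := by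
        intro i _
        have := abs_le.1 (hE i j).le
        rw [Matrix.col_apply]
        nlinarith
      simpa [dotProduct] using Finset.sum_le_card_nsmul _ _ _ this
    have h4 := abs_lt_of_sq_lt_sq' ((h2.trans
      (by gcongr)).trans_lt (ha j)) (mul_pos (hl j) ht0).le
    rw [h1, Matrix.add_apply, Matrix.vecMulVec_apply]
    linarith [h4.1]

/-- The general linear group over `U`, inside the group of invertible real matrices. -/
def subringUnits (U : Subring ℝ) (m : ℕ) : Subgroup (Matrix (Fin m) (Fin m) ℝ)ˣ where
  carrier := {V | entriesIn (U : Set ℝ) V.val ∧ entriesIn (U : Set ℝ) V⁻¹.val}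
  mul_mem' {V W} hV hW := by
    refine ⟨entriesIn_mul hV.1 hW.1, ?_⟩
    rw [_root_.mul_inv_rev]
    exact entriesIn_mul hW.2 hV.2
  one_mem' := by
    refine ⟨entriesIn_one, ?_⟩
    rw [inv_one]
    exact entriesIn_one
  inv_mem' {V} hV := ⟨hV.2, by rw [inv_inv]; exact hV.1⟩

/-- An invertible diagonal matrix. -/
noncomputable def diagonalUnit {m : ℕ} (d : Fin m → ℝ) (hd : ∀ i, d i ≠ 0) : (Matrix (Fin m) (Fin m) ℝ)ˣ where
  val := diagonal d
  inv := diagonal d⁻¹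
  val_inv := by
    rw [Matrix.diagonal_mul_diagonal, ← Matrix.diagonal_one]
    congr 1
    ext i
    exact mul_inv_cancel₀ (hd i)
  inv_val := by
    rw [Matrix.diagonal_mul_diagonal, ← Matrix.diagonal_one]
    congr 1
    ext i
    exact inv_mul_cancel₀ (hd i)

/-- An elementary transvection as an invertible matrix. -/
noncomputable def transvectionUnit {m : ℕ} {i j : Fin m} (h : i ≠ j) (c : ℝ) : (Matrix (Fin m) (Fin m) ℝ)ˣ where
  val := transvection i j c
  inv := transvection i j (-c)
  val_inv := by rw [Matrix.transvection_mul_transvection_same _ _ h, add_neg_cancel,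
    Matrix.transvection_zero]
  inv_val := by rw [Matrix.transvection_mul_transvection_same _ _ h, neg_add_cancel,
    Matrix.transvection_zero]

lemma continuous_transvectionUnit {m : ℕ} {i j : Fin m} (h : i ≠ j) :
    Continuous (transvectionUnit h) := by
  have h1 : Continuous fun c : ℝ => transvection i j c := by
    refine continuous_const.add (continuous_matrix fun a b => ?_)
    by_cases hab : i = a ∧ j = b
    · simp only [Matrix.single, Matrix.of_apply, if_pos hab]; exact continuous_id
    · simp only [Matrix.single, Matrix.of_apply, if_neg hab]; exact continuous_const
  exact Units.continuous_iff.2 ⟨h1, h1.comp continuous_neg⟩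

lemma entriesIn_transvection {U : Subring ℝ} {m : ℕ} (i j : Fin m) {c : ℝ} (hc : c ∈ U) :
    entriesIn (U : Set ℝ) (transvection i j c) := by
  intro a b
  rw [transvection, Matrix.add_apply]
  refine U.add_mem (entriesIn_one a b) ?_
  simp only [Matrix.single, Matrix.of_apply]
  split_ifs
  exacts [hc, U.zero_mem]

lemma transvectionUnit_mem_closure {U : Subring ℝ} (hU : Dense (U : Set ℝ)) {m : ℕ} {i j : Fin m}
    (h : i ≠ j) (c : ℝ) : transvectionUnit h c ∈ (subringUnits U m).topologicalClosure := by
  refine map_mem_closure (continuous_transvectionUnit h) (hU c) fun x hx => ?_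
  exact ⟨entriesIn_transvection i j hx, entriesIn_transvection i j (U.neg_mem hx)⟩

lemma exists_eq_mul_diagonalUnit {U : Subring ℝ} (hU : Dense (U : Set ℝ)) {m : ℕ}
    (M : Matrix (Fin m) (Fin m) ℝ) (hM : M.det ≠ 0) (d : Fin m → ℝ) (hd : ∀ i, d i ≠ 0) :
    ∃ g ∈ (subringUnits U m).topologicalClosure, ∃ d' : Fin m → ℝ, (∀ i, d' i ≠ 0) ∧
      diagonal d * M = g.val * diagonal d' := by
  revert d
  refine Matrix.diagonal_transvection_induction_of_det_ne_zero (fun M => ∀ d : Fin m → ℝ,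
    (∀ i, d i ≠ 0) → ∃ g ∈ (subringUnits U m).topologicalClosure, ∃ d' : Fin m → ℝ,
      (∀ i, d' i ≠ 0) ∧ diagonal d * M = g.val * diagonal d') M hM ?_ ?_ ?_
  · intro D hD d hd
    refine ⟨1, one_mem _, d * D, fun i => mul_ne_zero (hd i) ?_, ?_⟩
    · rw [Matrix.det_diagonal] at hD
      exact Finset.prod_ne_zero_iff.1 hD i (Finset.mem_univ i)
    · rw [Matrix.diagonal_mul_diagonal, Units.val_one, one_mul]
      rfl
  · intro t d hd
    refine ⟨_, transvectionUnit_mem_closure hU t.hij (d t.i * t.c / d t.j), d, hd, ?_⟩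
    change diagonal d * transvection t.i t.j t.c = transvection t.i t.j _ * diagonal d
    ext a b
    rw [Matrix.diagonal_mul, Matrix.mul_diagonal, transvection, transvection, Matrix.add_apply,
      Matrix.add_apply]
    simp only [Matrix.single, Matrix.of_apply, Matrix.one_apply]
    by_cases hab : t.i = a ∧ t.j = b
    · obtain ⟨rfl, rfl⟩ := hab
      have := hd t.j
      simp [t.hij]
      field_simp
    · rw [if_neg hab, if_neg hab]
      by_cases h : a = b
      · simp [h]
      · simp [h]
  · intro A B _ _ ihA ihB d hd
    obtain ⟨g, hg, d₁, hd₁, h₁⟩ := ihA d hd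
    obtain ⟨g', hg', d₂, hd₂, h₂⟩ := ihB d₁ hd₁
    refine ⟨g * g', mul_mem hg hg', d₂, hd₂, ?_⟩
    rw [← mul_assoc, h₁, mul_assoc, h₂, ← mul_assoc, Units.val_mul]

/-- Invertible real matrices are limits of matrices invertible over `U` with positively rescaled
columns. -/
lemma mem_closure_subringUnits_mul_diagonalUnit {U : Subring ℝ} (hU : Dense (U : Set ℝ)) {m : ℕ}
    (Y : (Matrix (Fin m) (Fin m) ℝ)ˣ) :
    Y ∈ closure {Z | ∃ V ∈ subringUnits U m, ∃ (d : Fin m → ℝ) (hd : ∀ i, d i ≠ 0),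
      (∀ i, 0 < d i) ∧ Z = V * diagonalUnit d hd} := by
  have hdet : Y.val.det ≠ 0 :=
    isUnit_iff_ne_zero.1 ((Matrix.isUnit_iff_isUnit_det _).1 Y.isUnit)
  obtain ⟨g, hg, d, hd, h⟩ := exists_eq_mul_diagonalUnit hU Y.val hdet 1 (fun _ => one_ne_zero)
  have hs : ∀ i, (SignType.sign (d i) : ℝ) ≠ 0 := fun i => by
    rcases lt_or_gt_of_ne (hd i) with h | h <;> simp [h]
  have hd' : ∀ i, |d i| ≠ 0 := fun i => abs_ne_zero.2 (hd i)
  have hsmem : diagonalUnit _ hs ∈ subringUnits U m := by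
    have key : ∀ e : Fin m → ℝ, (∀ i, e i ∈ U) → entriesIn (U : Set ℝ) (diagonal e) := by
      intro e he i j
      rw [Matrix.diagonal_apply]
      split_ifs
      exacts [he i, U.zero_mem]
    refine ⟨key _ fun i => ?_, key _ fun i => ?_⟩
    · rcases lt_or_gt_of_ne (hd i) with h | h
      · simp [h]
      · simp [h]
    · rcases lt_or_gt_of_ne (hd i) with h | h
      · simp [h]
      · simp [h]
  have hY : Y = (g * diagonalUnit _ hs) * diagonalUnit _ hd' := by
    ext1
    rw [show diagonal (1 : Fin m → ℝ) = 1 from Matrix.diagonal_one, one_mul] at h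
    rw [h, Units.val_mul, Units.val_mul, mul_assoc]
    change _ = g.val * (diagonal _ * diagonal _)
    rw [Matrix.diagonal_mul_diagonal]
    congr 3
    ext i
    exact (sign_mul_abs (d i)).symm
  rw [hY]
  have hmem : g * diagonalUnit _ hs ∈ closure (subringUnits U m : Set _) :=
    mul_mem hg ((subringUnits U m).le_topologicalClosure hsmem)
  exact map_mem_closure (f := fun V => V * diagonalUnit _ hd')
    (continuous_id.mul continuous_const) hmem fun V hV =>
    ⟨V, hV, _, hd', fun i => abs_pos.2 (hd i), rfl⟩

/-- The products `V * D`, with `V` invertible over `U` and `D` positive diagonal, for which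
`V⁻¹ * M * V` is strong shift equivalent to `A` over `U₊`. -/
def goodFrames (U : Subring ℝ) {n m : ℕ} (A : Matrix (Fin n) (Fin n) ℝ)
    (M : Matrix (Fin m) (Fin m) ℝ) : Set (Matrix (Fin m) (Fin m) ℝ)ˣ :=
  {Y | ∃ V ∈ subringUnits U m, ∃ (d : Fin m → ℝ) (hd : ∀ i, d i ≠ 0), (∀ i, 0 < d i) ∧
    Y = V * diagonalUnit d hd ∧ SSE (nonnegPart U) ⟨n, A⟩ ⟨m, V⁻¹.val * M * V.val⟩}

lemma pos_of_diagonalUnit_conj {m m' : ℕ} {V : (Matrix (Fin m) (Fin m) ℝ)ˣ}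
    {V' : (Matrix (Fin m') (Fin m') ℝ)ˣ} {d : Fin m → ℝ} {d' : Fin m' → ℝ}
    {hd : ∀ i, d i ≠ 0} {hd' : ∀ i, d' i ≠ 0} (hdpos : ∀ i, 0 < d i) (hdpos' : ∀ i, 0 < d' i)
    {R : Matrix (Fin m) (Fin m') ℝ}
    (h : ∀ i j, 0 < ((V * diagonalUnit d hd)⁻¹.val * R * (V' * diagonalUnit d' hd').val) i j)
    (i j) : 0 < (V⁻¹.val * R * V'.val) i j := by
  have h1 := h i j
  have h2 : (V * diagonalUnit d hd)⁻¹.val * R * (V' * diagonalUnit d' hd').val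
      = diagonal d⁻¹ * (V⁻¹.val * R * V'.val) * diagonal d' := by
    rw [_root_.mul_inv_rev, Units.val_mul, Units.val_mul]
    change diagonal d⁻¹ * _ * R * (_ * diagonal d') = _
    simp only [Matrix.mul_assoc]
  rw [h2, Matrix.mul_diagonal, Matrix.diagonal_mul] at h1
  exact (mul_pos_iff_of_pos_left (inv_pos.2 (hdpos i))).1
    ((mul_pos_iff_of_pos_right (hdpos' j)).1 h1)

lemma continuous_conj {m m' : ℕ} (R : Matrix (Fin m) (Fin m') ℝ) :
    Continuous fun p : (Matrix (Fin m) (Fin m) ℝ)ˣ × (Matrix (Fin m') (Fin m') ℝ)ˣ =>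
      p.1⁻¹.val * R * p.2.val := by
  have h1 : Continuous fun p : (Matrix (Fin m) (Fin m) ℝ)ˣ × (Matrix (Fin m') (Fin m') ℝ)ˣ =>
      p.1⁻¹.val := Units.continuous_val.comp continuous_fst.inv
  have h2 : Continuous fun p : (Matrix (Fin m) (Fin m) ℝ)ˣ × (Matrix (Fin m') (Fin m') ℝ)ˣ =>
      p.2.val := Units.continuous_val.comp continuous_snd
  exact (h1.matrix_mul continuous_const).matrix_mul h2

lemma isOpen_pos_entries {m n : ℕ} : IsOpen {M : Matrix (Fin m) (Fin n) ℝ | ∀ i j, 0 < M i j} := by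
  simp only [Set.ofPred_forall]
  exact isOpen_iInter_of_finite fun i => isOpen_iInter_of_finite fun j =>
    isOpen_lt continuous_const (continuous_id.matrix_elem i j)

/-- Positivity of an elementary equivalence between two frames propagates membership in the
closure of the good frames. -/
lemma mem_closure_goodFrames {U : Subring ℝ} (hU : Dense (U : Set ℝ)) {n m m' : ℕ}
    {A : Matrix (Fin n) (Fin n) ℝ} {R : Matrix (Fin m) (Fin m') ℝ} {S : Matrix (Fin m') (Fin m) ℝ}
    (hR : entriesIn (U : Set ℝ) R) (hS : entriesIn (U : Set ℝ) S)
    {Y : (Matrix (Fin m) (Fin m) ℝ)ˣ} (hY : Y ∈ closure (goodFrames U A (R * S)))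
    {Y' : (Matrix (Fin m') (Fin m') ℝ)ˣ}
    (h1 : ∀ i j, 0 < (Y⁻¹.val * R * Y'.val) i j) (h2 : ∀ i j, 0 < (Y'⁻¹.val * S * Y.val) i j) :
    Y' ∈ closure (goodFrames U A (S * R)) := by
  refine mem_closure_iff.2 fun O hO hYO => ?_
  have hmem : (Y, Y') ∈ closure (goodFrames U A (R * S) ×ˢ
      {Z | ∃ V ∈ subringUnits U m', ∃ (d : Fin m' → ℝ) (hd : ∀ i, d i ≠ 0),
        (∀ i, 0 < d i) ∧ Z = V * diagonalUnit d hd}) := by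
    rw [closure_prod_eq]
    exact ⟨hY, mem_closure_subringUnits_mul_diagonalUnit hU Y'⟩
  have hW1 := (isOpen_pos_entries (m := m) (n := m')).preimage (continuous_conj R)
  have hW2 := (isOpen_pos_entries (m := m') (n := m)).preimage
    ((continuous_conj S).comp continuous_swap)
  have hW3 : IsOpen {p : (Matrix (Fin m) (Fin m) ℝ)ˣ × (Matrix (Fin m') (Fin m') ℝ)ˣ | p.2 ∈ O} :=
    hO.preimage continuous_snd
  obtain ⟨⟨Z, Z'⟩, ⟨⟨hZ1, hZ2⟩, hZ3⟩, ⟨V, hV, d, hd, hdpos, hZ, hsse⟩, V', hV', d', hd', hdpos', hZ'⟩ :=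
    mem_closure_iff.1 hmem _ ((hW1.inter hW2).inter hW3) ⟨⟨h1, h2⟩, hYO⟩
  refine ⟨Z', hZ3, V', hV', d', hd', hdpos', hZ', hsse.tail ?_⟩
  simp only at hZ hZ'
  subst hZ hZ'
  have p1 := pos_of_diagonalUnit_conj hdpos hdpos' hZ1
  have p2 := pos_of_diagonalUnit_conj hdpos' hdpos hZ2
  refine ⟨V⁻¹.val * R * V'.val, V'⁻¹.val * S * V.val, fun i j => ⟨?_, (p1 i j).le⟩,
    fun i j => ⟨?_, (p2 i j).le⟩, ?_, ?_⟩
  · exact entriesIn_mul (entriesIn_mul hV.2 hR) hV'.1 i j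
  · exact entriesIn_mul (entriesIn_mul hV'.2 hS) hV.1 i j
  · change _ = V⁻¹.val * R * V'.val * (V'⁻¹.val * S * V.val)
    simp only [Matrix.mul_assoc]
    rw [← Matrix.mul_assoc V'.val, Units.mul_inv, Matrix.one_mul]
  · change _ = V'⁻¹.val * S * V.val * (V⁻¹.val * R * V'.val)
    simp only [Matrix.mul_assoc]
    rw [← Matrix.mul_assoc V.val, Units.mul_inv, Matrix.one_mul]

lemma one_mem_goodFrames (U : Subring ℝ) {n : ℕ} (A : Matrix (Fin n) (Fin n) ℝ) :
    1 ∈ goodFrames U A A := by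
  refine ⟨1, one_mem _, 1, fun _ => one_ne_zero, fun _ => one_pos, ?_, ?_⟩
  · ext1
    change _ = 1 * diagonal 1
    rw [one_mul]
    exact Matrix.diagonal_one.symm
  · rw [inv_one, Units.val_one, one_mul, mul_one]
    exact Relation.ReflTransGen.refl

/-- A positive conjugate by a limit of good frames can be perturbed to a conjugate over `U`. -/
lemma exists_sse_conj_pos {U : Subring ℝ} {n m : ℕ} {A : Matrix (Fin n) (Fin n) ℝ}
    {M : Matrix (Fin m) (Fin m) ℝ} {Y : (Matrix (Fin m) (Fin m) ℝ)ˣ}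
    (hY : Y ∈ closure (goodFrames U A M)) (hpos : ∀ i j, 0 < (Y⁻¹.val * M * Y.val) i j) :
    ∃ V ∈ subringUnits U m, (∀ i j, 0 < (V⁻¹.val * M * V.val) i j) ∧
      SSE (nonnegPart U) ⟨n, A⟩ ⟨m, V⁻¹.val * M * V.val⟩ := by
  have hW := (isOpen_pos_entries (m := m) (n := m)).preimage
    ((continuous_conj M).comp (continuous_id.prodMk continuous_id))
  obtain ⟨Z, hZ, V, hV, d, hd, hdpos, hZV, hsse⟩ := mem_closure_iff.1 hY _ hW hpos
  subst hZV
  exact ⟨V, hV, pos_of_diagonalUnit_conj hdpos hdpos hZ, hsse⟩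

/-- A nilpotent real matrix is a commutator with itself. -/
lemma exists_commutator_eq_of_isNilpotent {n : ℕ} {N : Matrix (Fin n) (Fin n) ℝ}
    (hN : IsNilpotent N) : ∃ H : Matrix (Fin n) (Fin n) ℝ, H * N - N * H = N := by
  by_contra hcon
  let ad : Matrix (Fin n) (Fin n) ℝ →ₗ[ℝ] Matrix (Fin n) (Fin n) ℝ :=
    LinearMap.mulRight ℝ N - LinearMap.mulLeft ℝ N
  have hmem : N ∉ LinearMap.range ad := fun ⟨H, hH⟩ => hcon ⟨H, hH⟩
  obtain ⟨φ, hφN, hφ⟩ := Submodule.exists_le_ker_of_notMem hmem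
  let C : Matrix (Fin n) (Fin n) ℝ := of fun i j => φ (single j i 1)
  have hC : ∀ X, φ X = (C * X).trace := by
    intro X
    conv_lhs => rw [Matrix.matrix_eq_sum_single X]
    simp only [map_sum, Matrix.trace, Matrix.diag, Matrix.mul_apply, C, Matrix.of_apply]
    rw [Finset.sum_comm]
    refine Finset.sum_congr rfl fun i _ => Finset.sum_congr rfl fun j _ => ?_
    rw [show single j i (X j i) = X j i • single j i (1 : ℝ) by
      rw [Matrix.smul_single, smul_eq_mul, mul_one], map_smul, smul_eq_mul, mul_comm]
  have hcomm : N * C = C * N := by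
    refine Matrix.ext_iff_trace_mul_right.2 fun H => ?_
    have h0 : φ (ad H) = 0 := hφ (LinearMap.mem_range_self ad H)
    rw [hC] at h0
    have h1 : ad H = H * N - N * H := rfl
    rw [h1, mul_sub, Matrix.trace_sub, sub_eq_zero, ← mul_assoc, ← mul_assoc] at h0
    rw [← h0, Matrix.trace_mul_cycle, Matrix.trace_mul_cycle]
  have hnil : IsNilpotent (C * N) :=
    Commute.isNilpotent_mul_left (show Commute C N from hcomm.symm) hN
  exact hφN ((hC N).trans (Matrix.isNilpotent_trace_of_isNilpotent hnil).eq_zero)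

open scoped Matrix.Norms.Operator in
lemma continuous_exp_smul {n : ℕ} (H : Matrix (Fin n) (Fin n) ℝ) :
    Continuous fun s : ℝ => NormedSpace.exp (s • H) :=
  NormedSpace.exp_continuous.comp (continuous_id.smul continuous_const)

open scoped Matrix.Norms.Operator in
lemma exp_smul_mul_eq_self {n : ℕ} {H P : Matrix (Fin n) (Fin n) ℝ} (h : H * P = 0) (s : ℝ) :
    NormedSpace.exp (s • H) * P = P := by
  have h1 : SemiconjBy P 0 (s • H) := by
    rw [SemiconjBy, mul_zero, smul_mul_assoc, h, smul_zero]
  have h2 := h1.exp_right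
  rw [SemiconjBy, NormedSpace.exp_zero, mul_one] at h2
  exact h2.symm

open scoped Matrix.Norms.Operator in
lemma mul_exp_smul_eq_self {n : ℕ} {H P : Matrix (Fin n) (Fin n) ℝ} (h : P * H = 0) (s : ℝ) :
    P * NormedSpace.exp (s • H) = P := by
  have h1 : SemiconjBy P (s • H) 0 := by
    rw [SemiconjBy, zero_mul, mul_smul_comm, h, smul_zero]
  have h2 := h1.exp_right
  rwa [SemiconjBy, NormedSpace.exp_zero, one_mul] at h2

open scoped Matrix.Norms.Operator in
lemma mul_exp_smul_of_commutator {n : ℕ} {H N : Matrix (Fin n) (Fin n) ℝ}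
    (h : H * N - N * H = N) (s : ℝ) :
    N * NormedSpace.exp (s • H) = Real.exp (-s) • (NormedSpace.exp (s • H) * N) := by
  have h1 : SemiconjBy N (s • H) (s • H + algebraMap ℝ _ (-s)) := by
    rw [SemiconjBy, add_mul, mul_smul_comm, smul_mul_assoc, ← Algebra.smul_def, neg_smul,
      ← sub_eq_add_neg, ← smul_sub]
    congr 1
    rw [eq_sub_iff_add_eq, ← eq_sub_iff_add_eq', h]
  have h2 := h1.exp_right
  rw [SemiconjBy, NormedSpace.exp_add_of_commute (Algebra.commutes _ _).symm,
    ← NormedSpace.algebraMap_exp_comm, ← Real.exp_eq_exp_ℝ, mul_assoc,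
    ← Algebra.smul_def, mul_smul_comm] at h2
  exact h2

lemma exists_adapted_commutator {n : ℕ} {N P : Matrix (Fin n) (Fin n) ℝ} (hN : IsNilpotent N)
    (hPP : P * P = P) (hPN : P * N = 0) (hNP : N * P = 0) :
    ∃ H : Matrix (Fin n) (Fin n) ℝ, H * N - N * H = N ∧ H * P = 0 ∧ P * H = 0 := by
  obtain ⟨H, hH⟩ := exists_commutator_eq_of_isNilpotent hN
  have h1 : (1 - P) * N = N := by rw [sub_mul, one_mul, hPN, sub_zero]
  have h2 : N * (1 - P) = N := by rw [mul_sub, mul_one, hNP, sub_zero]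
  have h3 : (1 - P) * P = 0 := by rw [sub_mul, one_mul, hPP, sub_self]
  have h4 : P * (1 - P) = 0 := by rw [mul_sub, mul_one, hPP, sub_self]
  refine ⟨(1 - P) * H * (1 - P), ?_, ?_, ?_⟩
  · clear h3 h4
    generalize 1 - P = Q at *
    have h1' : ∀ X, Q * (N * X) = N * X := fun X => by rw [← mul_assoc, h1]
    have h2' : ∀ X, N * (Q * X) = N * X := fun X => by rw [← mul_assoc, h2]
    calc Q * H * Q * N - N * (Q * H * Q)
        = Q * (H * N - N * H) * Q := by
          rw [mul_sub, sub_mul]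
          simp only [mul_assoc, h1, h2, h1', h2']
      _ = N := by rw [hH, h1, h2]
  · rw [mul_assoc, h3, mul_zero]
  · rw [← mul_assoc, ← mul_assoc, h4, zero_mul, zero_mul]

/-- A positive matrix of eventual rank one can be conjugated, through positive matrices, to
matrices arbitrarily close to its spectral projection. -/
lemma exists_contraction {n : ℕ} {lam : ℝ} {N P : Matrix (Fin n) (Fin n) ℝ} (hN : IsNilpotent N)
    (hPP : P * P = P) (hPN : P * N = 0) (hNP : N * P = 0) (hP : ∀ i j, 0 < P i j) (hlam : 0 < lam)
    (hA : ∀ i j, 0 < (lam • P + N) i j) :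
    ∃ X : (Matrix (Fin n) (Fin n) ℝ)ˣ, ∃ q : ℝ, 0 < q ∧ q < 1 ∧ X.val * P = P ∧
      P * X.val = P ∧ N * X.val = q • (X.val * N) ∧ (∀ i j, 0 < X.val i j) ∧
      ∀ t : ℝ, 0 ≤ t → t ≤ 1 → ∀ i j, 0 < (X⁻¹.val * (lam • P + t • N)) i j := by
  obtain ⟨H, hHN, hHP, hPH⟩ := exists_adapted_commutator hN hPP hPN hNP
  have hev1 : ∀ᶠ c : ℝ in nhds 1, ∀ i j, 0 < (lam • P + c⁻¹ • N) i j := by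
    have hcont : ContinuousAt (fun c : ℝ => lam • P + c⁻¹ • N) 1 :=
      continuousAt_const.add ((continuousAt_inv₀ one_ne_zero).smul continuousAt_const)
    refine hcont.eventually_mem (isOpen_pos_entries.mem_nhds ?_)
    rw [inv_one, one_smul]
    exact hA
  obtain ⟨c, hc1, hc2, hc⟩ : ∃ c : ℝ, 0 < c ∧ c < 1 ∧ ∀ i j, 0 < (lam • P + c⁻¹ • N) i j := by
    have h1 := (hev1.filter_mono nhdsWithin_le_nhds).and
      (Ioo_mem_nhdsLT (show (0 : ℝ) < 1 from one_pos))
    obtain ⟨c, hc, hc0, hc1⟩ := h1.exists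
    exact ⟨c, hc0, hc1, hc⟩
  have hev2 : ∀ᶠ s : ℝ in nhds 0, ∀ i j,
      0 < (c • NormedSpace.exp (s • H) + (1 - c) • P) i j := by
    have hcont : Continuous fun s : ℝ => c • NormedSpace.exp (s • H) + (1 - c) • P :=
      ((continuous_exp_smul H).const_smul c).add continuous_const
    refine hcont.continuousAt.eventually_mem (isOpen_pos_entries.mem_nhds fun i j => ?_)
    rw [zero_smul, NormedSpace.exp_zero, Matrix.add_apply, Matrix.smul_apply, Matrix.smul_apply]
    refine add_pos_of_nonneg_of_pos (smul_nonneg hc1.le ?_) (mul_pos (sub_pos.2 hc2) (hP i j))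
    rw [Matrix.one_apply]
    split_ifs
    exacts [zero_le_one, le_rfl]
  have hev3 : ∀ᶠ s : ℝ in nhds 0, ∀ i j,
      0 < (lam • P + c⁻¹ • (NormedSpace.exp ((-s) • H) * N)) i j := by
    have hcont : Continuous fun s : ℝ => lam • P + c⁻¹ • (NormedSpace.exp ((-s) • H) * N) :=
      continuous_const.add
        ((((continuous_exp_smul H).comp continuous_neg).matrix_mul continuous_const).const_smul c⁻¹)
    refine hcont.continuousAt.eventually_mem (isOpen_pos_entries.mem_nhds ?_)
    rw [neg_zero, zero_smul, NormedSpace.exp_zero, one_mul]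
    exact hc
  obtain ⟨s, ⟨hX, hXN⟩, hs⟩ : ∃ s : ℝ, ((∀ i j, 0 < (c • NormedSpace.exp (s • H) + (1 - c) • P) i j)
      ∧ ∀ i j, 0 < (lam • P + c⁻¹ • (NormedSpace.exp ((-s) • H) * N)) i j) ∧ 0 < s :=
    (((hev2.and hev3).filter_mono nhdsWithin_le_nhds).and
      (self_mem_nhdsWithin : Set.Ioi (0 : ℝ) ∈ nhdsWithin 0 (Set.Ioi 0))).exists
  have hGP := exp_smul_mul_eq_self hHP s
  have hPG := mul_exp_smul_eq_self hPH s
  have hGP' := exp_smul_mul_eq_self hHP (-s)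
  have hPG' := mul_exp_smul_eq_self hPH (-s)
  have hNG := mul_exp_smul_of_commutator hHN s
  have hGG : NormedSpace.exp (s • H) * NormedSpace.exp ((-s) • H) = 1 := by
    rw [← Matrix.exp_add_of_commute _ _ (((Commute.refl H).smul_left s).smul_right (-s)),
      ← add_smul, add_neg_cancel, zero_smul, NormedSpace.exp_zero]
  have hGG' : NormedSpace.exp ((-s) • H) * NormedSpace.exp (s • H) = 1 := by
    rw [← Matrix.exp_add_of_commute _ _ (((Commute.refl H).smul_left (-s)).smul_right s),
      ← add_smul, neg_add_cancel, zero_smul, NormedSpace.exp_zero]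
  generalize NormedSpace.exp (s • H) = G at *
  generalize NormedSpace.exp ((-s) • H) = G' at *
  have hinv : ∀ (c : ℝ) (G G' : Matrix (Fin n) (Fin n) ℝ), c ≠ 0 → G * G' = 1 → G * P = P →
      P * G' = P → (c • G + (1 - c) • P) * (c⁻¹ • G' + (1 - c⁻¹) • P) = 1 := by
    intro c G G' hc h1 h2 h3
    simp only [add_mul, mul_add, smul_mul_smul_comm, h1, h2, h3, hPP, mul_inv_cancel₀ hc,
      one_smul, add_assoc, ← add_smul]
    convert add_zero _
    rw [show (1 - c) * c⁻¹ + (c * (1 - c⁻¹) + (1 - c) * (1 - c⁻¹)) = 0 by field_simp; ring,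
      zero_smul]
  refine ⟨⟨c • G + (1 - c) • P, c⁻¹ • G' + (1 - c⁻¹) • P, hinv c G G' hc1.ne' hGG hGP hPG', ?_⟩,
    Real.exp (-s), Real.exp_pos _, Real.exp_lt_one_iff.2 (neg_lt_zero.2 hs), ?_, ?_, ?_, hX, ?_⟩
  · simpa only [inv_inv] using hinv c⁻¹ G' G (inv_ne_zero hc1.ne') hGG' hGP' hPG
  · change (c • G + (1 - c) • P) * P = P
    rw [add_mul, smul_mul_assoc, smul_mul_assoc, hGP, hPP, ← add_smul, add_sub_cancel, one_smul]
  · change P * (c • G + (1 - c) • P) = P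
    rw [mul_add, mul_smul_comm, mul_smul_comm, hPG, hPP, ← add_smul, add_sub_cancel, one_smul]
  · change N * (c • G + (1 - c) • P) = _ • ((c • G + (1 - c) • P) * N)
    rw [mul_add, add_mul, mul_smul_comm, mul_smul_comm, smul_mul_assoc, smul_mul_assoc, hNP, hPN,
      smul_zero, add_zero, add_zero, hNG, smul_comm]
  · intro t ht0 ht1 i j
    change 0 < ((c⁻¹ • G' + (1 - c⁻¹) • P) * (lam • P + t • N)) i j
    have h1 : (c⁻¹ • G' + (1 - c⁻¹) • P) * (lam • P + t • N)
        = (1 - t) • lam • P + t • (lam • P + c⁻¹ • (G' * N)) := by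
      simp only [add_mul, mul_add, smul_mul_smul_comm, hGP', hPN, hPP, smul_zero, add_zero]
      module
    rw [h1, Matrix.add_apply, Matrix.smul_apply, Matrix.smul_apply, Matrix.smul_apply]
    have h2 : 0 < lam * P i j := mul_pos hlam (hP i j)
    have h3 := hXN i j
    simp only [smul_eq_mul]
    rcases ht0.eq_or_lt with rfl | ht
    · simpa using h2
    · exact add_pos_of_nonneg_of_pos (mul_nonneg (sub_nonneg.2 ht1) h2.le) (mul_pos ht h3)

/-- A positive matrix of eventual rank one, viewed over `ℝ`, is linked through limits of good
frames to matrices close to a multiple of its spectral projection. -/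
lemma exists_goodFrame_near_proj {U : Subring ℝ} (hU : Dense (U : Set ℝ)) {n : ℕ} {lam : ℝ}
    (hlam : 0 < lam) {A : Matrix (Fin n) (Fin n) ℝ} (hAU : entriesIn (U : Set ℝ) A)
    (hA : ∀ i j, 0 < A i j) {r l : Fin n → ℝ} (h : EvRankOne lam A r l) (hr : ∀ i, 0 < r i)
    (hl : ∀ i, 0 < l i) {ε : ℝ} (hε : 0 < ε) :
    ∃ Z ∈ closure (goodFrames U A A), ∃ E : Matrix (Fin n) (Fin n) ℝ,
      Z⁻¹.val * A * Z.val = lam • vecMulVec r l + E ∧ E *ᵥ r = 0 ∧ l ᵥ* E = 0 ∧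
      ∀ i j, |E i j| < ε := by
  set P := vecMulVec r l with hPdef
  set N := A - lam • P with hNdef
  have hPP : P * P = P := by
    rw [hPdef, Matrix.vecMulVec_mul_vecMulVec, h.dot, one_smul]
  have hPN : P * N = 0 := by rw [hNdef, mul_sub, h.proj_mul, mul_smul_comm, hPP, sub_self]
  have hNP : N * P = 0 := by rw [hNdef, sub_mul, h.mul_proj, smul_mul_assoc, hPP, sub_self]
  have hAN : A = lam • P + N := (add_sub_cancel _ _).symm
  obtain ⟨X, q, hq0, hq1, hXP, hPX, hNX, hX, hXN⟩ := exists_contraction h.nilpotent hPP hPN hNP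
    (fun i j => mul_pos (hr i) (hl j)) hlam (fun i j => by rw [← hNdef, ← hAN]; exact hA i j)
  have hconj : ∀ i : ℕ, A * (X ^ i).val = (X ^ i).val * (lam • P + q ^ i • N) := by
    intro i
    induction i with
    | zero => rw [pow_zero, pow_zero, Units.val_one, mul_one, one_mul, one_smul, hAN]
    | succ i ih =>
      rw [pow_succ, Units.val_mul, ← mul_assoc, ih, mul_assoc, mul_assoc]
      congr 1
      rw [add_mul, mul_add, smul_mul_assoc, smul_mul_assoc, hNX, hPX, mul_smul_comm,
        mul_smul_comm, hXP, smul_smul, pow_succ]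
  have hconj' : ∀ i : ℕ, (X ^ i)⁻¹.val * A * (X ^ i).val = lam • P + q ^ i • N := fun i => by
    rw [mul_assoc, hconj, ← mul_assoc, Units.inv_mul, one_mul]
  have hmem : ∀ i : ℕ, X ^ i ∈ closure (goodFrames U A A) := by
    intro i
    induction i with
    | zero => rw [pow_zero]; exact subset_closure (one_mem_goodFrames U A)
    | succ i ih =>
      have hstep := mem_closure_goodFrames hU (A := A) (R := 1) (S := A) (Y := X ^ i)
        (Y' := X ^ (i + 1)) entriesIn_one hAU (by rwa [one_mul]) ?_ ?_
      · rwa [mul_one] at hstep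
      · rw [mul_one, ← Units.val_mul, pow_succ, inv_mul_cancel_left]
        exact hX
      · rw [pow_succ, _root_.mul_inv_rev, Units.val_mul, mul_assoc, mul_assoc, ← mul_assoc _ A, hconj']
        exact hXN _ (pow_nonneg hq0.le i) (pow_le_one₀ hq0.le hq1.le)
  have hlim : Filter.Tendsto (fun p : ℕ => q ^ p • N) Filter.atTop (nhds 0) := by
    have := (tendsto_pow_atTop_nhds_zero_of_lt_one hq0.le hq1).smul_const N
    rwa [zero_smul] at this
  have hopen : IsOpen {M : Matrix (Fin n) (Fin n) ℝ | ∀ i j, |M i j| < ε} := by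
    simp only [Set.ofPred_forall]
    exact isOpen_iInter_of_finite fun i => isOpen_iInter_of_finite fun j =>
      isOpen_lt (continuous_id.matrix_elem i j).abs continuous_const
  obtain ⟨p, hp⟩ := (hlim.eventually_mem (hopen.mem_nhds fun i j => by simpa using hε)).exists
  have hNr : N *ᵥ r = 0 := by
    rw [hNdef, Matrix.sub_mulVec, h.right, Matrix.smul_mulVec, hPdef, Matrix.vecMulVec_mulVec, h.dot]
    simp
  have hlN : l ᵥ* N = 0 := by
    rw [hNdef, Matrix.vecMul_sub, h.left, Matrix.vecMul_smul, hPdef, Matrix.vecMul_vecMulVec, h.dot,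
      one_smul, sub_self]
  exact ⟨X ^ p, hmem p, q ^ p • N, hconj' p, by rw [Matrix.smul_mulVec, hNr, smul_zero],
    by rw [Matrix.vecMul_smul, hlN, smul_zero], hp⟩

/-- An elementary strong shift equivalence over `U` out of a positive matrix of eventual rank one
lifts, after a change of basis over `U` of the target, to strong shift equivalence over `U₊`. -/
lemma exists_sse_conj_of_esse {U : Subring ℝ} (hU : Dense (U : Set ℝ)) {n m : ℕ} {lam : ℝ}
    (hlam : 0 < lam) {R : Matrix (Fin n) (Fin m) ℝ} {S : Matrix (Fin m) (Fin n) ℝ}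
    (hR : entriesIn (U : Set ℝ) R) (hS : entriesIn (U : Set ℝ) S)
    (hA : ∀ i j, 0 < (R * S) i j) (hev : ∃ r l, EvRankOne lam (R * S) r l) :
    ∃ V ∈ subringUnits U m, (∀ i j, 0 < (V⁻¹.val * (S * R) * V.val) i j) ∧
      SSE (nonnegPart U) ⟨n, R * S⟩ ⟨m, V⁻¹.val * (S * R) * V.val⟩ := by
  obtain ⟨r₀, l₀, h₀⟩ := hev
  have hne : Nonempty (Fin n) := h₀.nonempty
  obtain ⟨r, l, h, hr, hl⟩ := h₀.exists_pos hlam fun k hk => pow_pos_entries hA hk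
  obtain ⟨ε, hε, hcone⟩ := exists_cone (m := m) hlam hr hl h.dot
  obtain ⟨Z, hZ, E, hZE, hEr, hlE, hEε⟩ :=
    exists_goodFrame_near_proj hU hlam (entriesIn_mul hR hS) hA h hr hl hε
  obtain ⟨Y, hY1, hY2⟩ := hcone (Z⁻¹.val * R) (S * Z.val) E
    (by rw [← hZE]; simp only [Matrix.mul_assoc]) hEr hlE hEε
  have hYmem := mem_closure_goodFrames hU hR hS hZ hY1
    (by simpa only [Matrix.mul_assoc] using hY2)
  refine exists_sse_conj_pos hYmem fun i j => ?_
  have hfac : Y⁻¹.val * (S * R) * Y.val = (Y⁻¹.val * (S * Z.val)) * (Z⁻¹.val * R * Y.val) := by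
    simp only [Matrix.mul_assoc]
    rw [← Matrix.mul_assoc Z.val, Units.mul_inv, Matrix.one_mul]
  rw [hfac]
  exact mul_pos_entry (fun i j => (hY2 i j).le) (fun i j => (hY1 i j).le) hne.some (hY2 _ _) (hY1 _ _)

/-- A strong shift equivalence over `U` out of a positive matrix of eventual rank one lifts, after
a change of basis over `U` of the target, to strong shift equivalence over `U₊`. -/
lemma exists_sse_conj_of_sse {U : Subring ℝ} (hU : Dense (U : Set ℝ)) {n : ℕ} {lam : ℝ}
    (hlam : 0 < lam) {A : Matrix (Fin n) (Fin n) ℝ} (hA : ∀ i j, 0 < A i j)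
    (hev : ∃ r l, EvRankOne lam A r l) {p : (m : ℕ) × Matrix (Fin m) (Fin m) ℝ}
    (h : SSE (U : Set ℝ) ⟨n, A⟩ p) :
    ∃ V ∈ subringUnits U p.1, (∀ i j, 0 < (V⁻¹.val * p.2 * V.val) i j) ∧
      SSE (nonnegPart U) ⟨n, A⟩ ⟨p.1, V⁻¹.val * p.2 * V.val⟩ := by
  induction h with
  | refl =>
    refine ⟨1, one_mem _, ?_, ?_⟩ <;> rw [inv_one, Units.val_one, one_mul, mul_one]
    exacts [hA, Relation.ReflTransGen.refl]
  | tail hab hbc ih =>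
    obtain ⟨V, hV, hpos, hsse⟩ := ih
    obtain ⟨R, S, hR, hS, h1, h2⟩ := hbc
    have hev' := hsse.exists_evRankOne hlam.ne' hev
    have hfac : V⁻¹.val * (R * S) * V.val = (V⁻¹.val * R) * (S * V.val) := by
      simp only [Matrix.mul_assoc]
    have hfac' : (S * V.val) * (V⁻¹.val * R) = S * R := by
      rw [Matrix.mul_assoc, ← Matrix.mul_assoc V.val, Units.mul_inv, Matrix.one_mul]
    simp only [h1, hfac] at hpos hsse hev'
    obtain ⟨W, hW, hWpos, hWsse⟩ := exists_sse_conj_of_esse hU hlam (entriesIn_mul hV.2 hR)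
      (entriesIn_mul hS hV.1) hpos hev'
    rw [hfac', ← h2] at hWpos hWsse
    exact ⟨W, hW, hWpos, hsse.trans hWsse⟩

lemma sse_nonnegPart_of_shiftEquivToScalar {U : Subring ℝ} [IsDedekindDomain U]
    (hU : Dense (U : Set ℝ)) {N : ℕ} {A : Matrix (Fin N) (Fin N) ℝ}
    (hA : entriesIn (nonnegPart U) A) {lam : ℝ} (hlam : lam ≠ 0)
    (hev : ∃ r l, EvRankOne lam A r l) (h : ShiftEquivToScalar (U : Set ℝ) A lam) :
    SSE (nonnegPart U) ⟨N, A⟩ ⟨1, Matrix.of fun _ _ => lam⟩ := by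
  have hAU : entriesIn (U : Set ℝ) A := fun i j => (hA i j).1
  obtain ⟨r, l, hrl⟩ := hev
  have hlamU : lam ∈ U := by
    rw [← hrl.trace_eq]
    exact U.sum_mem fun i _ => hAU i i
  obtain ⟨hpos, m, B, hAB, -, hB⟩ := exists_sse_pos hU hlam A hA ⟨r, l, hrl⟩
  have hBA : SSE (U : Set ℝ) ⟨m, B⟩ ⟨N, A⟩ := SSE.mono (fun _ hx => hx.1) (sse_symm hAB)
  obtain ⟨V, -, -, hV⟩ := exists_sse_conj_of_sse hU hpos hB
    (SSE.exists_evRankOne hlam hAB ⟨r, l, hrl⟩)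
    (hBA.trans (sse_of_shiftEquivToScalar U hAU hlam hlamU h))
  have hscalar : V⁻¹.val * (Matrix.of fun _ _ => lam) * V.val = Matrix.of fun _ _ => lam := by
    rw [scalar_one_eq_smul_one, mul_smul_comm, mul_one, smul_mul_assoc, Units.inv_mul]
  rw [hscalar] at hV
  exact hAB.trans hV

/-- Let `U` be a nondiscrete unital subring of `ℝ` and `A` a nonnegative eventually
rank one matrix over `U` with nonzero eigenvalue `lam` (so `charpoly A = X^(N-1)(X - lam)`).
(1) If `U` is a Dedekind domain and `A` is shift equivalent over `U` to `(lam)`, then `A`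
is SSE over `U₊` to `(lam)`.  (2) If `U` is a principal ideal domain, then `A` is SSE
over `U₊` to `(lam)`. -/
theorem dedekind_theorem (U : Subring ℝ) (hU : Dense (U : Set ℝ))
    {N : ℕ} (A : Matrix (Fin N) (Fin N) ℝ) (hAU : entriesIn (U : Set ℝ) A)
    (hAnn : ∀ i j, 0 ≤ A i j) (lam : ℝ) (hlam : lam ≠ 0)
    (hchar : A.charpoly = X ^ (N - 1) * (X - C lam)) :
    (IsDedekindDomain U → ShiftEquivToScalar (U : Set ℝ) A lam →
      SSE {x : ℝ | x ∈ U ∧ 0 ≤ x} ⟨N, A⟩ ⟨1, Matrix.of fun _ _ => lam⟩) ∧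
    (IsPrincipalIdealRing U →
      SSE {x : ℝ | x ∈ U ∧ 0 ≤ x} ⟨N, A⟩ ⟨1, Matrix.of fun _ _ => lam⟩) := by
  have hA : entriesIn (nonnegPart U) A := fun i j => ⟨hAU i j, hAnn i j⟩
  obtain ⟨r, l, hrl⟩ := evRankOne_of_charpoly A hlam hchar
  refine ⟨fun hD h => sse_nonnegPart_of_shiftEquivToScalar hU hA hlam ⟨r, l, hrl⟩ h, fun hP => ?_⟩
  exact sse_nonnegPart_of_shiftEquivToScalar hU hA hlam ⟨r, l, hrl⟩
    (shiftEquivToScalar_of_isPrincipalIdealRing U hAU hlam hrl)
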